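/- Let g = e^{2u} g_euc be a smooth conformal metric on the unit disk D, and suppose that μ(B_r^g(z), g)/(π r²) < Λ₁ for every r > 0 and every z ∈ D_{3/4}. Then there exists ε₀ = ε₀(Λ₁) with ε₀ < 4π/3 such that if ∫_D |K(g)| dμ_g ≤ ε₀, then ‖∇u‖_{L^{2,∞}(D_{1/2})} < C and, for every p ∈ (1,2), ‖u‖_{W^{1,p}(D_{1/2})} ≤ C (1 + |log μ(D_{1/2}, g)|), where the constants C depend only on Λ₁, ε₀ and p. -/

import Mathlib

open MeasureTheory Filter Metric
open scoped Topology ENNReal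

noncomputable section

/-- The Laplacian of `u : ℂ → ℝ` (sum of the two pure second derivatives). -/
def lap (u : ℂ → ℝ) (x : ℂ) : ℝ :=
  iteratedFDeriv ℝ 2 u x ![1, 1] + iteratedFDeriv ℝ 2 u x ![Complex.I, Complex.I]

/-- Gauss curvature of the conformal metric `e^{2u} g_euc`: `K = -e^{-2u} Δu`. -/
def gauss (u : ℂ → ℝ) (x : ℂ) : ℝ := -Real.exp (-(2 * u x)) * lap u x

/-- Area `μ(A, g)` of a set for the metric `g = e^{2u} g_euc`. -/
def confAreaE (u : ℂ → ℝ) (A : Set ℂ) : ℝ≥0∞ :=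
  ∫⁻ x in A, ENNReal.ofReal (Real.exp (2 * u x))

/-- Total curvature `∫_A |K(g)| dμ_g` of the metric `g = e^{2u} g_euc`. -/
def curvIntE (u : ℂ → ℝ) (A : Set ℂ) : ℝ≥0∞ :=
  ∫⁻ x in A, ENNReal.ofReal (|gauss u x| * Real.exp (2 * u x))

/-- `C¹` paths from `x` to `y` staying in `S`. -/
def PathsIn (S : Set ℂ) (x y : ℂ) : Set (ℝ → ℂ) :=
  {γ | γ 0 = x ∧ γ 1 = y ∧ (∀ t ∈ Set.Icc (0:ℝ) 1, γ t ∈ S) ∧ ContDiff ℝ 1 γ}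

/-- Length of a path for the metric `e^{2u} g_euc`. -/
def confLen (u : ℂ → ℝ) (γ : ℝ → ℂ) : ℝ :=
  ∫ t in (0:ℝ)..1, Real.exp (u (γ t)) * ‖deriv γ t‖

/-- Geodesic distance (within `S`) of the conformal metric `e^{2u} g_euc`. -/
def confDist (u : ℂ → ℝ) (S : Set ℂ) (x y : ℂ) : ℝ :=
  sInf (confLen u '' PathsIn S x y)

/-- Metric ball `B_r^g(z)` of the conformal metric (within `S`). -/
def confBall (u : ℂ → ℝ) (S : Set ℂ) (z : ℂ) (r : ℝ) : Set ℂ :=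
  {x ∈ S | confDist u S z x < r}

/-- `‖f‖_{L^{2,∞}(Ω)} ≤ C`, i.e. `t·|{|f| > t}|^{1/2} ≤ C` for all `t > 0`. -/
def wL2Bound (f : ℂ → ℝ) (Ω : Set ℂ) (C : ℝ) : Prop :=
  ∀ t : ℝ, 0 < t → t * (volume {x ∈ Ω | t < |f x|}).toReal ^ ((1:ℝ)/2) ≤ C

/-- The `W^{1,p}(Ω)` norm of a differentiable function (via its classical gradient). -/
def w1pNormE (u : ℂ → ℝ) (Ω : Set ℂ) (p : ℝ) : ℝ≥0∞ :=
  (∫⁻ x in Ω, ENNReal.ofReal (|u x| ^ p)) ^ (1/p)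
    + (∫⁻ x in Ω, ENNReal.ofReal (‖fderiv ℝ u x‖ ^ p)) ^ (1/p)

/-- Real dot product on `ℂ = ℝ²`. -/
def dotC (a b : ℂ) : ℝ := a.re * b.re + a.im * b.im

/-- `V` is the distributional (weak) gradient of `u` on `Ω`. -/
def IsWeakGradOn (Ω : Set ℂ) (u : ℂ → ℝ) (V : ℂ → ℂ) : Prop :=
  ∀ φ : ℂ → ℝ, ContDiff ℝ (⊤ : ℕ∞) φ → HasCompactSupport φ → tsupport φ ⊆ Ω →
    ∀ w : ℂ, ∫ x in Ω, u x * fderiv ℝ φ x w = -∫ x in Ω, dotC (V x) w * φ x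

/-- `v k → u` weakly in `W^{1,p}(Ω)`: uniformly bounded `W^{1,p}` norms together with
convergence, tested against smooth compactly supported functions, of the functions and of
their weak gradients. -/
def WeakW1pLim (Ω : Set ℂ) (p : ℝ) (v : ℕ → ℂ → ℝ) (u : ℂ → ℝ) : Prop :=
  ∃ V : ℕ → ℂ → ℂ,
    (∀ k, IsWeakGradOn Ω (v k) (V k)) ∧
    (∃ C : ℝ, ∀ k, (∫ x in Ω, |v k x| ^ p) ^ (1/p)
        + (∫ x in Ω, ‖V k x‖ ^ p) ^ (1/p) ≤ C) ∧
    (∀ φ : ℂ → ℝ, ContDiff ℝ (⊤ : ℕ∞) φ → HasCompactSupport φ → tsupport φ ⊆ Ω →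
      Tendsto (fun k => ∫ x in Ω, v k x * φ x) atTop (𝓝 (∫ x in Ω, u x * φ x)) ∧
      ∀ w : ℂ, Tendsto (fun k => ∫ x in Ω, dotC (V k x) w * φ x) atTop
        (𝓝 (-∫ x in Ω, u x * fderiv ℝ φ x w)))

/-- Mean value of `φ` on a set. -/
def avgOn (φ : ℂ → ℝ) (A : Set ℂ) : ℝ := (volume A).toReal⁻¹ * ∫ x in A, φ x

/-- Mean oscillation of `φ` on the disk `D_t(x₀)`. -/
def meanOsc (φ : ℂ → ℝ) (x₀ : ℂ) (t : ℝ) : ℝ :=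
  avgOn (fun x => |φ x - avgOn φ (ball x₀ t)|) (ball x₀ t)

/-- The John–Nirenberg radius `ρ(φ, x₀, Ω, λ)`. -/
def jnRad (φ : ℂ → ℝ) (x₀ : ℂ) (Ω : Set ℂ) (lam : ℝ) : ℝ :=
  sSup {r : ℝ | 0 ≤ r ∧ ∀ t : ℝ, 0 < t → t < r → ball x₀ t ⊆ Ω ∧ meanOsc φ x₀ t ≤ lam}

/-- Mean value of `u` along the circle `∂D_r(0)`. -/
def circMean (u : ℂ → ℝ) (r : ℝ) : ℝ :=
  (2 * Real.pi)⁻¹ * ∫ θ in (0:ℝ)..(2 * Real.pi), u ((r : ℂ) * Complex.exp ((θ : ℂ) * Complex.I))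

/-- Completeness of the conformal metric `e^{2v} g_euc` on all of `ℂ`. -/
def ConfComplete (v : ℂ → ℝ) : Prop :=
  ∀ x : ℕ → ℂ,
    (∀ ε : ℝ, 0 < ε → ∃ N : ℕ, ∀ m ≥ N, ∀ n ≥ N, confDist v Set.univ (x m) (x n) < ε) →
    ∃ l : ℂ, Tendsto (fun n => confDist v Set.univ (x n) l) atTop (𝓝 0)

/-- `(D, g_k)` extends to a complete conformal surface with total curvature at most `Λ`. -/
def ExtendsComplete (u : ℂ → ℝ) (Λ : ℝ) : Prop :=
  ∃ v : ℂ → ℝ, ContDiff ℝ (⊤ : ℕ∞) v ∧ Set.EqOn v u (ball (0:ℂ) 1) ∧ ConfComplete v ∧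
    curvIntE v Set.univ ≤ ENNReal.ofReal Λ

/-- Gromov–Hausdorff convergence of `(S, dk k)` to `(S, d)`, phrased through
correspondences of small distortion. -/
def GHTendsto (S : Set ℂ) (dk : ℕ → ℂ → ℂ → ℝ) (d : ℂ → ℂ → ℝ) : Prop :=
  ∀ ε : ℝ, 0 < ε → ∀ᶠ k in atTop, ∃ R : Set (ℂ × ℂ),
    (∀ p ∈ R, p.1 ∈ S ∧ p.2 ∈ S) ∧
    (∀ x ∈ S, ∃ y ∈ S, (x, y) ∈ R) ∧
    (∀ y ∈ S, ∃ x ∈ S, (x, y) ∈ R) ∧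
    (∀ p ∈ R, ∀ q ∈ R, |dk k p.1 q.1 - d p.2 q.2| < ε)

/-- `−Δu = f` on `Ω` in the sense of distributions. -/
def DistribLaplaceEq (Ω : Set ℂ) (u f : ℂ → ℝ) : Prop :=
  ∀ φ : ℂ → ℝ, ContDiff ℝ (⊤ : ℕ∞) φ → HasCompactSupport φ → tsupport φ ⊆ Ω →
    -∫ x in Ω, u x * lap φ x = ∫ x in Ω, f x * φ x

lemma ker_ball (ρ : ℝ) (hρ : 0 < ρ) (ζ : ℂ) :
    ∫⁻ x in ball ζ ρ, ‖x - ζ‖ₑ⁻¹ ≤ ENNReal.ofReal (2 * Real.pi * ρ) := by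
  have h1 : ∫⁻ x in ball ζ ρ, ‖x - ζ‖ₑ⁻¹ =
      ∫⁻ x, (ball (0:ℂ) ρ).indicator (fun y => ‖y‖ₑ⁻¹) x := by
    rw [← lintegral_indicator measurableSet_ball,
      ← lintegral_sub_right_eq_self (fun x => (ball (0:ℂ) ρ).indicator (fun y => ‖y‖ₑ⁻¹) x) ζ]
    congr 1; ext x
    by_cases hx : x ∈ ball ζ ρ
    · have : x - ζ ∈ ball (0:ℂ) ρ := by simpa [dist_eq_norm] using hx
      simp only [Set.indicator_of_mem hx, Set.indicator_of_mem this]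
    · have : x - ζ ∉ ball (0:ℂ) ρ := by simpa [dist_eq_norm] using hx
      simp only [Set.indicator_of_notMem hx, Set.indicator_of_notMem this]
  rw [h1, ← Complex.lintegral_comp_polarCoord_symm]
  have h2 : ∀ p ∈ polarCoord.target, ENNReal.ofReal p.1 •
      (ball (0:ℂ) ρ).indicator (fun y => ‖y‖ₑ⁻¹) (Complex.polarCoord.symm p) ≤
      (Set.Ioo 0 ρ ×ˢ Set.Ioo (-Real.pi) Real.pi).indicator (fun _ => (1:ℝ≥0∞)) p := by
    intro p hp
    have hp' : 0 < p.1 ∧ p.2 ∈ Set.Ioo (-Real.pi) Real.pi := hp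
    by_cases hx : p.1 < ρ
    · have hm : p ∈ (Set.Ioo 0 ρ ×ˢ Set.Ioo (-Real.pi) Real.pi) := ⟨⟨hp'.1, hx⟩, hp'.2⟩
      have hn : ‖Complex.polarCoord.symm p‖ₑ = ENNReal.ofReal p.1 := by
        rw [← ofReal_norm, Complex.norm_polarCoord_symm, abs_of_pos hp'.1]
      rw [Set.indicator_of_mem hm]
      refine le_trans (mul_le_mul_right (Set.indicator_le_self _ _ _) _) ?_
      rw [hn]
      exact ENNReal.mul_inv_le_one _
    · have : Complex.polarCoord.symm p ∉ ball (0:ℂ) ρ := by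
        rw [mem_ball_zero_iff, Complex.norm_polarCoord_symm, abs_of_pos hp'.1]; exact hx
      rw [Set.indicator_of_notMem this]; simp
  refine (setLIntegral_mono' polarCoord.open_target.measurableSet h2).trans ?_
  refine (setLIntegral_le_lintegral _ _).trans ?_
  rw [lintegral_indicator (measurableSet_Ioo.prod measurableSet_Ioo)]
  rw [setLIntegral_one, Measure.volume_eq_prod, Measure.prod_prod, Real.volume_Ioo, Real.volume_Ioo,
    ← ENNReal.ofReal_mul (by linarith)]
  apply ENNReal.ofReal_le_ofReal
  linarith

lemma ker_set (E : Set ℂ) (V : ℝ) (hV : 0 < V) (hE : volume E ≤ ENNReal.ofReal (V ^ 2)) (ζ : ℂ) :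
    ∫⁻ x in E, ‖x - ζ‖ₑ⁻¹ ≤ ENNReal.ofReal (8 * V) := by
  have h1 : ∫⁻ x in E, ‖x - ζ‖ₑ⁻¹ ≤ (∫⁻ x in ball ζ V, ‖x - ζ‖ₑ⁻¹) +
      ∫⁻ x in E, (ENNReal.ofReal V)⁻¹ := by
    rw [← lintegral_indicator measurableSet_ball]
    calc ∫⁻ x in E, ‖x - ζ‖ₑ⁻¹ ≤ ∫⁻ x in E,
          ((ball ζ V).indicator (fun x => ‖x - ζ‖ₑ⁻¹) x + (ENNReal.ofReal V)⁻¹) := by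
          apply lintegral_mono
          intro x
          by_cases hx : x ∈ ball ζ V
          · simp only [Set.indicator_of_mem hx]; exact le_self_add
          · simp only [Set.indicator_of_notMem hx, zero_add]
            apply ENNReal.inv_le_inv.2
            rw [← ofReal_norm]
            apply ENNReal.ofReal_le_ofReal
            simpa [dist_eq_norm] using hx
      _ = _ := lintegral_add_right _ measurable_const
      _ ≤ _ := add_le_add (setLIntegral_le_lintegral _ _) le_rfl
  refine h1.trans ?_
  rw [setLIntegral_const]
  calc _ ≤ ENNReal.ofReal (2 * Real.pi * V) + (ENNReal.ofReal V)⁻¹ * ENNReal.ofReal (V ^ 2) := by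
        exact add_le_add (ker_ball V hV ζ) (mul_le_mul_right hE _)
    _ = ENNReal.ofReal (2 * Real.pi * V + V⁻¹ * V ^ 2) := by
        rw [← ENNReal.ofReal_inv_of_pos hV, ← ENNReal.ofReal_mul (by positivity),
          ← ENNReal.ofReal_add (by positivity) (by positivity)]
    _ ≤ _ := by
        apply ENNReal.ofReal_le_ofReal
        have : V⁻¹ * V ^ 2 = V := by field_simp
        rw [this]
        nlinarith [Real.pi_lt_d2]

/-- Tonelli with kernel -/
lemma ker_tonelli (E : Set ℂ) (V : ℝ) (hV : 0 < V) (hE : volume E ≤ ENNReal.ofReal (V ^ 2))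
    (F : ℂ → ℝ) (hF : Measurable F) (ε : ℝ) (hε : 0 ≤ ε) (hFε : ∫⁻ ζ, ‖F ζ‖ₑ ≤ ENNReal.ofReal ε)
    (τ : ℂ → ℂ) (hτ : Measurable τ) :
    ∫⁻ x in E, ∫⁻ ζ, ‖F ζ‖ₑ * ‖x - τ ζ‖ₑ⁻¹ ≤ ENNReal.ofReal (8 * V * ε) := by
  rw [lintegral_lintegral_swap (by
    apply Measurable.aemeasurable; fun_prop)]
  calc ∫⁻ ζ, ∫⁻ x in E, ‖F ζ‖ₑ * ‖x - τ ζ‖ₑ⁻¹ ≤ ∫⁻ ζ, ‖F ζ‖ₑ * ENNReal.ofReal (8 * V) := by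
        apply lintegral_mono
        intro ζ
        simp only
        rw [lintegral_const_mul _ (by fun_prop)]
        gcongr
        exact ker_set E V hV hE _
    _ = (∫⁻ ζ, ‖F ζ‖ₑ) * ENNReal.ofReal (8 * V) := lintegral_mul_const _ (by fun_prop)
    _ ≤ ENNReal.ofReal ε * ENNReal.ofReal (8 * V) := by gcongr
    _ = _ := by rw [← ENNReal.ofReal_mul hε, mul_comm]

lemma cp_zero (V : ℂ → ℂ) (hV : ContDiff ℝ 1 V) (hc : HasCompactSupport V) :
    ∫ η, (fderiv ℝ V η 1 + Complex.I * fderiv ℝ V η Complex.I) / η = -(2 * Real.pi * V 0) := by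
  obtain ⟨R0, hR0, hR0s⟩ : ∃ R : ℝ, 0 < R ∧ ∀ η : ℂ, R ≤ ‖η‖ → V η = 0 ∧ fderiv ℝ V η = 0 := by
    obtain ⟨R, hR⟩ := hc.isCompact.isBounded.subset_ball (0:ℂ)
    refine ⟨max R 1, by positivity, fun η hη => ?_⟩
    have hn : η ∉ tsupport V := fun h => by
      have := hR h
      rw [mem_ball_zero_iff] at this
      exact absurd (le_trans (le_max_left _ _) hη) (not_le.2 this)
    refine ⟨image_eq_zero_of_notMem_tsupport hn, ?_⟩
    have : η ∉ tsupport (fderiv ℝ V) := fun h => hn (tsupport_fderiv_subset ℝ h)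
    exact image_eq_zero_of_notMem_tsupport this
  set e : ℝ → ℂ := fun θ => (Real.cos θ : ℂ) + (Real.sin θ : ℂ) * Complex.I with he
  have hec : Continuous e := by fun_prop
  have hen : ∀ θ, ‖e θ‖ = 1 := fun θ => by
    have := Complex.norm_polarCoord_symm (1, θ)
    simpa [he] using this
  have hdV : Continuous (fderiv ℝ V) := hV.continuous_fderiv (by norm_num)
  set A : ℝ × ℝ → ℂ := fun p => fderiv ℝ V (p.1 * e p.2) (e p.2) with hA
  set B : ℝ × ℝ → ℂ := fun p => fderiv ℝ V (p.1 * e p.2) (Complex.I * e p.2) with hB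
  have hAc : Continuous A := by
    apply Continuous.clm_apply <;> fun_prop
  have hBc : Continuous B := by
    apply Continuous.clm_apply <;> fun_prop
  have hz : ∀ p : ℝ × ℝ, R0 ≤ p.1 → A p = 0 ∧ B p = 0 := by
    intro p hp
    have : R0 ≤ ‖(p.1 : ℂ) * e p.2‖ := by
      rw [norm_mul, hen, mul_one, Complex.norm_real, Real.norm_eq_abs]
      exact hp.trans (le_abs_self _)
    simp [hA, hB, (hR0s _ this).2]
  set T : Set (ℝ × ℝ) := Set.Ioi (0 : ℝ) ×ˢ Set.Ioo (-Real.pi) Real.pi with hT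
  have hTm : MeasurableSet T := measurableSet_Ioi.prod measurableSet_Ioo
  have hint : ∀ G : ℝ × ℝ → ℂ, Continuous G → (∀ p : ℝ × ℝ, R0 ≤ p.1 → G p = 0) →
      IntegrableOn G T := by
    intro G hG hG0
    have h1 : IntegrableOn G (Set.Icc 0 R0 ×ˢ Set.Icc (-Real.pi) Real.pi) :=
      hG.continuousOn.integrableOn_compact (isCompact_Icc.prod isCompact_Icc)
    refine h1.of_forall_sdiff_eq_zero hTm ?_
    rintro p ⟨hp1, hp2⟩
    apply hG0
    by_contra hlt
    exact hp2 ⟨⟨le_of_lt hp1.1, le_of_lt (not_le.1 hlt)⟩, Set.Ioo_subset_Icc_self hp1.2⟩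
  have hAi := hint A hAc (fun p hp => (hz p hp).1)
  have hBi := hint B hBc (fun p hp => (hz p hp).2)
  have hdiff : ∀ x, HasFDerivAt V (fderiv ℝ V x) x := fun x =>
    (hV.differentiable (by norm_num) x).hasFDerivAt
  have hed : ∀ θ : ℝ, HasDerivAt e (Complex.I * e θ) θ := by
    intro θ
    have h1 := (Real.hasDerivAt_cos θ).ofReal_comp
    have h2 := ((Real.hasDerivAt_sin θ).ofReal_comp).mul_const Complex.I
    refine (h1.add h2).congr_deriv ?_
    simp only [he]; push_cast; ring_nf; simp
  have key : ∫ η, (fderiv ℝ V η 1 + Complex.I * fderiv ℝ V η Complex.I) / η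
      = ∫ p in T, (A p + Complex.I * B p) := by
    rw [← Complex.integral_comp_polarCoord_symm]
    refine setIntegral_congr_fun hTm ?_
    intro p hp
    have hp1 : (p.1 : ℂ) ≠ 0 := by exact_mod_cast (ne_of_gt hp.1)
    have he0 : e p.2 ≠ 0 := fun h => by have := hen p.2; rw [h] at this; simp at this
    have hs : Complex.polarCoord.symm p = p.1 * e p.2 := by
      rw [Complex.polarCoord_symm_apply]
    simp only [hs, hA, hB]
    set D := fderiv ℝ V (p.1 * e p.2)
    have d1 : D (e p.2) = (Real.cos p.2 : ℂ) * D 1 + (Real.sin p.2 : ℂ) * D Complex.I := by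
      have : e p.2 = Real.cos p.2 • (1:ℂ) + Real.sin p.2 • Complex.I := by simp [he]
      rw [this, map_add, map_smul, map_smul]; simp
    have d2 : D (Complex.I * e p.2) =
        -(Real.sin p.2 : ℂ) * D 1 + (Real.cos p.2 : ℂ) * D Complex.I := by
      have : Complex.I * e p.2 = (-Real.sin p.2) • (1:ℂ) + Real.cos p.2 • Complex.I := by
        apply Complex.ext <;> simp [he]
      rw [this, map_add, map_smul, map_smul]; simp
    have d3 : D 1 + Complex.I * D Complex.I = e p.2 * (D (e p.2) + Complex.I * D (Complex.I * e p.2)) := by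
      rw [d1, d2]
      have hcs : (Real.cos p.2 : ℂ) ^ 2 + (Real.sin p.2 : ℂ) ^ 2 = 1 := by
        exact_mod_cast Real.cos_sq_add_sin_sq p.2
      simp only [he]
      linear_combination (-(D 1 + Complex.I * D Complex.I)) * hcs +
        ((Real.sin p.2 : ℂ) ^ 2 * D 1 - (Real.sin p.2 : ℂ) * (Real.cos p.2 : ℂ) * D Complex.I
          ) * Complex.I_sq
    rw [d3, Complex.real_smul]
    field_simp
  rw [key, integral_add hAi (hBi.const_mul _), integral_const_mul]
  have hμ : (volume : Measure (ℝ × ℝ)).restrict T =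
      (volume.restrict (Set.Ioi (0:ℝ))).prod (volume.restrict (Set.Ioo (-Real.pi) Real.pi)) := by
    rw [Measure.prod_restrict]; rfl
  have hB0 : ∫ p in T, B p = 0 := by
    unfold IntegrableOn at hBi
    rw [hμ] at hBi ⊢
    rw [integral_prod _ hBi]
    rw [setIntegral_congr_fun measurableSet_Ioi (g := fun _ => (0:ℂ))]
    · simp
    intro r hr
    have hr0 : (r : ℂ) ≠ 0 := by exact_mod_cast (ne_of_gt hr)
    simp only
    rw [← integral_Ioc_eq_integral_Ioo, ← intervalIntegral.integral_of_le (by linarith [Real.pi_pos])]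
    have hder : ∀ θ ∈ Set.uIcc (-Real.pi) Real.pi,
        HasDerivAt (fun θ : ℝ => (r:ℂ)⁻¹ * V (r * e θ)) (B (r, θ)) θ := by
      intro θ _
      have h1 : HasDerivAt (fun θ : ℝ => (r:ℂ) * e θ) (r * (Complex.I * e θ)) θ := (hed θ).const_mul _
      have h2 := ((hdiff (r * e θ)).comp_hasDerivAt θ h1).const_mul ((r:ℂ)⁻¹)
      refine h2.congr_deriv ?_
      rw [← Complex.real_smul (x := r) (z := Complex.I * e θ), map_smul, Complex.real_smul]
      simp only [hB]
      field_simp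
    rw [intervalIntegral.integral_eq_sub_of_hasDerivAt hder]
    · simp [he]
    · apply Continuous.intervalIntegrable; fun_prop
  have hA0 : ∫ p in T, A p = -(2 * Real.pi * V 0) := by
    unfold IntegrableOn at hAi
    rw [hμ] at hAi ⊢
    rw [integral_prod_symm _ hAi]
    rw [setIntegral_congr_fun measurableSet_Ioo (g := fun _ => - V 0)]
    · simp; left; rw [max_eq_left (by linarith [Real.pi_pos])]; push_cast; ring
    intro θ _
    simp only
    have hder : ∀ r ∈ Set.Ici (0:ℝ), HasDerivAt (fun r : ℝ => V (r * e θ)) (A (r, θ)) r := by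
      intro r _
      have h1 : HasDerivAt (fun r : ℝ => (r:ℂ) * e θ) (1 * e θ) r :=
        (Complex.ofRealCLM.hasDerivAt (x := r)).mul_const _
      have h2 := ((hdiff (r * e θ)).comp_hasDerivAt r h1)
      rw [one_mul] at h2
      exact h2
    have hI : IntegrableOn (fun r => A (r, θ)) (Set.Ioi 0) := by
      have h1 : IntegrableOn (fun r => A (r, θ)) (Set.Icc 0 R0) := by
        apply ContinuousOn.integrableOn_compact isCompact_Icc
        fun_prop
      refine h1.of_forall_sdiff_eq_zero measurableSet_Ioi ?_
      rintro r ⟨hr1, hr2⟩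
      refine (hz (r, θ) ?_).1
      by_contra hlt
      exact hr2 ⟨le_of_lt hr1, le_of_lt (not_le.1 hlt)⟩
    have hlim : Tendsto (fun r : ℝ => V (r * e θ)) atTop (𝓝 0) := by
      apply tendsto_const_nhds.congr'
      filter_upwards [eventually_ge_atTop R0] with r hr
      refine (hR0s _ ?_).1.symm
      rw [norm_mul, hen, mul_one, Complex.norm_real, Real.norm_eq_abs]
      exact hr.trans (le_abs_self _)
    rw [integral_Ioi_of_hasDerivAt_of_tendsto' hder hI hlim]
    simp
  rw [hA0, hB0]; simp

lemma cauchy_pompeiu (W : ℂ → ℂ) (hW : ContDiff ℝ 1 W) (hc : HasCompactSupport W) (z : ℂ) :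
    W z = (2 * Real.pi)⁻¹ *
      ∫ ζ, (fderiv ℝ W ζ 1 + Complex.I * fderiv ℝ W ζ Complex.I) / (z - ζ) := by
  have h := cp_zero (fun η => W (η + z)) (hW.comp (contDiff_id.add contDiff_const))
    (hc.comp_homeomorph (Homeomorph.addRight z))
  have h2 : ∀ η, fderiv ℝ (fun η => W (η + z)) η = fderiv ℝ W (η + z) := fun η =>
    fderiv_comp_add_right z
  simp only [h2, zero_add] at h
  rw [← integral_add_right_eq_self _ z]
  have h3 : ∀ η : ℂ, (fderiv ℝ W (η + z) 1 + Complex.I * fderiv ℝ W (η + z) Complex.I) / (z - (η + z))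
     = -((fderiv ℝ W (η + z) 1 + Complex.I * fderiv ℝ W (η + z) Complex.I) / η) := by
    intro η
    rw [show z - (η + z) = -η by ring, div_neg]
  simp only [h3, integral_neg, h, neg_neg]
  have : (Real.pi : ℂ) ≠ 0 := by exact_mod_cast Real.pi_ne_zero
  push_cast
  field_simp

lemma two_le_top' : (2 : WithTop ℕ∞) ≤ ((⊤ : ℕ∞) : WithTop ℕ∞) :=
  WithTop.coe_le_coe.2 (le_top : (2 : ℕ∞) ≤ ⊤)

/-- complex gradient `u_x - i u_y` -/
def gr (u : ℂ → ℝ) (z : ℂ) : ℂ := (fderiv ℝ u z 1 : ℂ) - Complex.I * (fderiv ℝ u z Complex.I : ℂ)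

lemma fderiv_eq_gr (u : ℂ → ℝ) (z w : ℂ) : fderiv ℝ u z w = (gr u z * w).re := by
  have : w = w.re • (1:ℂ) + w.im • Complex.I := by apply Complex.ext <;> simp
  conv_lhs => rw [this, map_add, map_smul, map_smul]
  simp [gr]; ring

lemma norm_fderiv_le_gr (u : ℂ → ℝ) (z : ℂ) : ‖fderiv ℝ u z‖ ≤ ‖gr u z‖ := by
  refine ContinuousLinearMap.opNorm_le_bound _ (norm_nonneg _) (fun w => ?_)
  rw [fderiv_eq_gr, ← norm_mul]
  exact Complex.abs_re_le_norm _

lemma int_ker (G : ℂ → ℂ) (hG : Continuous G) (hc : HasCompactSupport G) (z : ℂ) :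
    Integrable (fun ζ => G ζ / (z - ζ)) := by
  refine ⟨(hG.measurable.div (by fun_prop)).aestronglyMeasurable, ?_⟩
  obtain ⟨C, hC⟩ := hG.bounded_above_of_compact_support hc
  have hfin : volume (tsupport G) < ∞ := hc.isCompact.measure_lt_top
  set V : ℝ := (volume (tsupport G)).toReal + 1 with hV
  have hV1 : 1 ≤ V := by simp [hV]
  have hE : volume (tsupport G) ≤ ENNReal.ofReal (V ^ 2) := by
    rw [ENNReal.le_ofReal_iff_toReal_le hfin.ne (by positivity)]
    nlinarith
  have hb := ker_set (tsupport G) V (by linarith) hE z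
  unfold HasFiniteIntegral
  have hle : ∫⁻ ζ, ‖G ζ / (z - ζ)‖ₑ ≤ ∫⁻ ζ in tsupport G, ENNReal.ofReal C * ‖ζ - z‖ₑ⁻¹ := by
    rw [← lintegral_indicator (isClosed_tsupport G).measurableSet]
    apply lintegral_mono
    intro ζ
    by_cases hζ : ζ ∈ tsupport G
    · simp only [Set.indicator_of_mem hζ]
      by_cases h0 : z - ζ = 0
      · simp [h0]
      rw [div_eq_mul_inv, enorm_mul, enorm_inv h0, ← enorm_neg (z - ζ), neg_sub]
      gcongr
      rw [← ofReal_norm]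
      exact ENNReal.ofReal_le_ofReal (hC ζ)
    · simp [image_eq_zero_of_notMem_tsupport hζ]
  refine lt_of_le_of_lt hle ?_
  rw [lintegral_const_mul _ (by fun_prop)]
  exact ENNReal.mul_lt_top ENNReal.ofReal_lt_top (lt_of_le_of_lt hb ENNReal.ofReal_lt_top)

lemma hol_ker (G : ℂ → ℂ) (hG : Continuous G) (hc : HasCompactSupport G) (ρ : ℝ)
    (h0 : ∀ ζ ∈ ball (0:ℂ) ρ, G ζ = 0) :
    DifferentiableOn ℂ (fun z => ∫ ζ, G ζ / (z - ζ)) (ball (0:ℂ) ρ) := by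
  intro z0 hz0
  rw [mem_ball_zero_iff] at hz0
  set s := (ρ - ‖z0‖) / 2 with hs
  have hspos : 0 < s := by rw [hs]; linarith
  have hfar : ∀ z ∈ ball z0 s, ∀ ζ, G ζ ≠ 0 → s ≤ ‖z - ζ‖ := by
    intro z hz ζ hζ
    have h1 : ρ ≤ ‖ζ‖ := by
      by_contra hlt
      exact hζ (h0 ζ (by rw [mem_ball_zero_iff]; linarith))
    rw [mem_ball, dist_eq_norm] at hz
    have h2 : ‖ζ‖ ≤ ‖ζ - z‖ + ‖z - z0‖ + ‖z0‖ := by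
      have := norm_add₃_le (a := ζ - z) (b := z - z0) (c := z0)
      simpa using this
    rw [norm_sub_rev]
    linarith
  have := hasDerivAt_integral_of_dominated_loc_of_deriv_le (μ := (volume : Measure ℂ))
    (F := fun z ζ => G ζ / (z - ζ)) (F' := fun z ζ => -(G ζ) / (z - ζ) ^ 2) (x₀ := z0)
    (s := ball z0 s) (bound := fun ζ => ‖G ζ‖ * (s ^ 2)⁻¹)
    (ball_mem_nhds _ hspos)
    (Eventually.of_forall fun z => (int_ker G hG hc z).aestronglyMeasurable)
    (int_ker G hG hc z0)
    ((hG.measurable.neg.div (by fun_prop)).aestronglyMeasurable)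
    (Eventually.of_forall fun ζ z hz => by
      by_cases hζ : G ζ = 0
      · simp [hζ]
      have := hfar z hz ζ hζ
      rw [norm_div, norm_neg, norm_pow, div_eq_mul_inv]
      gcongr)
    ((hG.norm.integrable_of_hasCompactSupport hc.norm).mul_const _)
    (Eventually.of_forall fun ζ z hz => by
      by_cases hζ : G ζ = 0
      · simpa [hζ] using hasDerivAt_const z (0:ℂ)
      have h3 := hfar z hz ζ hζ
      have h4 : z - ζ ≠ 0 := fun h => by rw [h, norm_zero] at h3; linarith
      have h5 := (hasDerivAt_const z (G ζ)).div ((hasDerivAt_id z).sub_const ζ) h4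
      refine h5.congr_deriv ?_
      simp)
  exact this.2.differentiableAt.differentiableWithinAt

lemma dbar_gr (u : ℂ → ℝ) (z : ℂ) (hu : ContDiffAt ℝ (⊤ : ℕ∞) u z) :
    ContDiffAt ℝ (⊤ : ℕ∞) (gr u) z ∧
    fderiv ℝ (gr u) z 1 + Complex.I * fderiv ℝ (gr u) z Complex.I = (lap u z : ℂ) := by
  have hd : ContDiffAt ℝ (⊤ : ℕ∞) (fderiv ℝ u) z := hu.fderiv_right (by simp)
  have hcd : ∀ w : ℂ, ContDiffAt ℝ (⊤ : ℕ∞) (fun x => (fderiv ℝ u x w : ℂ)) z := fun w =>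
    Complex.ofRealCLM.contDiff.contDiffAt.comp z (hd.clm_apply contDiffAt_const)
  have hg : ContDiffAt ℝ (⊤ : ℕ∞) (gr u) z := by
    unfold gr
    exact (hcd 1).sub (contDiffAt_const.mul (hcd Complex.I))
  refine ⟨hg, ?_⟩
  have hD : HasFDerivAt (fderiv ℝ u) (fderiv ℝ (fderiv ℝ u) z) z :=
    (hd.differentiableAt (by simp)).hasFDerivAt
  set D2 := fderiv ℝ (fderiv ℝ u) z with hD2
  have hw : ∀ w : ℂ, HasFDerivAt (fun x => (fderiv ℝ u x w : ℂ))
      (Complex.ofRealCLM.comp (D2.flip w)) z := by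
    intro w
    have h1 : HasFDerivAt (fun x => fderiv ℝ u x w) (D2.flip w) z := by
      have := hD.clm_apply (hasFDerivAt_const w z)
      refine this.congr_fderiv ?_
      ext v; simp
    exact Complex.ofRealCLM.hasFDerivAt.comp z h1
  have hgd : HasFDerivAt (gr u) (Complex.ofRealCLM.comp (D2.flip 1) -
      Complex.I • Complex.ofRealCLM.comp (D2.flip Complex.I)) z := by
    unfold gr
    exact (hw 1).sub ((hw Complex.I).const_mul Complex.I)
  rw [hgd.fderiv]
  have hsymm : D2 1 Complex.I = D2 Complex.I 1 :=
    (hu.isSymmSndFDerivAt (by simpa using two_le_top')) 1 Complex.I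
  have hlap : lap u z = D2 1 1 + D2 Complex.I Complex.I := by
    simp [lap, iteratedFDeriv_two_apply, hD2]
  rw [hlap]
  simp [hsymm]
  linear_combination (-(D2 Complex.I Complex.I : ℂ)) * Complex.I_sq

/-- the logarithmic-gradient potential -/
def pot (F : ℂ → ℝ) (z : ℂ) : ℂ := ((2 * Real.pi)⁻¹ : ℝ) * ∫ ζ, (F ζ : ℂ) / (z - ζ)

lemma decomp (u : ℂ → ℝ) (hu : ContDiffOn ℝ (⊤ : ℕ∞) u (ball (0:ℂ) 1)) :
    ∃ (F : ℂ → ℝ) (H : ℂ → ℂ), Continuous F ∧ HasCompactSupport F ∧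
      (∀ ζ, ζ ∉ ball (0:ℂ) 1 → F ζ = 0) ∧ (∀ ζ, |F ζ| ≤ |lap u ζ|) ∧
      DifferentiableOn ℂ H (ball (0:ℂ) (7/8)) ∧
      ∀ z ∈ ball (0:ℂ) (7/8), gr u z = H z + pot F z := by
  let φ : ContDiffBump (0:ℂ) := ⟨7/8, 15/16, by norm_num, by norm_num⟩
  have hua : ∀ z ∈ ball (0:ℂ) 1, ContDiffAt ℝ (⊤ : ℕ∞) u z := fun z hz =>
    hu.contDiffAt (isOpen_ball.mem_nhds hz)
  have hts : tsupport φ = closedBall (0:ℂ) (15/16) := φ.tsupport_eq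
  have hout : ∀ z, z ∉ ball (0:ℂ) 1 → ∀ᶠ x in 𝓝 z, φ x = 0 := by
    intro z hz
    have : z ∉ tsupport φ := by
      rw [hts, mem_closedBall_zero_iff]
      rw [mem_ball_zero_iff] at hz
      linarith
    exact notMem_tsupport_iff_eventuallyEq.1 this
  have hφs : ContDiff ℝ (⊤ : ℕ∞) (fun x => (φ x : ℂ)) :=
    Complex.ofRealCLM.contDiff.comp φ.contDiff
  set W : ℂ → ℂ := fun z => (φ z : ℂ) * gr u z with hW
  have hWs : ContDiff ℝ (⊤ : ℕ∞) W := by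
    rw [contDiff_iff_contDiffAt]
    intro z
    by_cases hz : z ∈ ball (0:ℂ) 1
    · exact hφs.contDiffAt.mul (dbar_gr u z (hua z hz)).1
    · apply (contDiffAt_const (c := (0:ℂ))).congr_of_eventuallyEq
      filter_upwards [hout z hz] with x hx
      simp [hW, hx]
  have hcφ : HasCompactSupport φ := φ.hasCompactSupport
  have hcW : HasCompactSupport W := by
    apply hcφ.mono
    intro x hx
    contrapose! hx
    simp at hx
    simp [hW, hx]
  have hW1 : ContDiff ℝ 1 W := hWs.of_le (by exact_mod_cast le_top)
  set F : ℂ → ℝ := fun ζ => φ ζ * lap u ζ with hF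
  have hFc : Continuous F := by
    rw [continuous_iff_continuousAt]
    intro z
    by_cases hz : z ∈ ball (0:ℂ) 1
    · apply φ.continuous.continuousAt.mul
      have h2 : ContinuousAt (iteratedFDeriv ℝ 2 u) z :=
        (hua z hz).continuousAt_iteratedFDeriv two_le_top'
      have ha : ∀ m : Fin 2 → ℂ, ContinuousAt (fun x => iteratedFDeriv ℝ 2 u x m) z := fun m =>
        (ContinuousMultilinearMap.apply ℝ (fun _ : Fin 2 => ℂ) ℝ m).continuous.continuousAt.comp h2
      exact (ha _).add (ha _)
    · apply (continuousAt_const (y := (0:ℝ))).congr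
      filter_upwards [hout z hz] with x hx
      simp [hF, hx]
  have hcF : HasCompactSupport F := hcφ.mul_right
  have hF0 : ∀ ζ, ζ ∉ ball (0:ℂ) 1 → F ζ = 0 := fun ζ hζ => by
    simp [hF, (hout ζ hζ).self_of_nhds]
  set Q : ℂ → ℂ := fun ζ => fderiv ℝ W ζ 1 + Complex.I * fderiv ℝ W ζ Complex.I with hQ
  have hdW : Continuous (fderiv ℝ W) := hW1.continuous_fderiv (by norm_num)
  have hQc : Continuous Q := by
    apply Continuous.add
    · exact hdW.clm_apply continuous_const
    · exact continuous_const.mul (hdW.clm_apply continuous_const)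
  have hcQ : HasCompactSupport Q := by
    apply (hcW.fderiv ℝ).mono
    intro x hx
    contrapose! hx
    simp at hx
    simp [hQ, hx]
  have hFCc : Continuous (fun ζ => (F ζ : ℂ)) := Complex.continuous_ofReal.comp hFc
  have hcFC : HasCompactSupport (fun ζ => (F ζ : ℂ)) := by
    apply hcF.mono
    intro x hx
    contrapose! hx
    simp at hx
    simp [hx]
  set G : ℂ → ℂ := fun ζ => Q ζ - F ζ with hG
  have hGc : Continuous G := hQc.sub hFCc
  have hcG : HasCompactSupport G := hcQ.sub hcFC
  have hin : ∀ z ∈ ball (0:ℂ) (7/8), ∀ᶠ x in 𝓝 z, φ x = 1 := by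
    intro z hz
    filter_upwards [isOpen_ball.mem_nhds hz] with x hx
    exact φ.one_of_mem_closedBall (ball_subset_closedBall hx)
  have hG0 : ∀ ζ ∈ ball (0:ℂ) (7/8), G ζ = 0 := by
    intro z hz
    have h1 : W =ᶠ[𝓝 z] gr u := by
      filter_upwards [hin z hz] with x hx
      simp [hW, hx]
    have hz1 : z ∈ ball (0:ℂ) 1 := ball_subset_ball (by norm_num) hz
    simp only [hG, hQ, hF]
    rw [h1.fderiv_eq, (dbar_gr u z (hua z hz1)).2, (hin z hz).self_of_nhds]
    simp
  refine ⟨F, fun z => ((2 * Real.pi)⁻¹ : ℝ) * ∫ ζ, G ζ / (z - ζ), hFc, hcF, hF0, ?_, ?_, ?_⟩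
  · intro ζ
    simp only [hF, abs_mul]
    rw [abs_of_nonneg φ.nonneg]
    exact mul_le_of_le_one_left (abs_nonneg _) φ.le_one
  · exact (hol_ker G hGc hcG _ hG0).const_mul _
  · intro z hz
    have h1 : W z = gr u z := by simp [hW, (hin z hz).self_of_nhds]
    rw [← h1, cauchy_pompeiu W hW1 hcW z]
    unfold pot
    rw [← mul_add, ← integral_add (int_ker G hGc hcG z) (int_ker _ hFCc hcFC z)]
    congr 2
    ext ζ
    simp only [hG, hQ]
    ring

lemma enorm_pot_le (F : ℂ → ℝ) (x : ℂ) :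
    ‖pot F x‖ₑ ≤ ENNReal.ofReal (2 * Real.pi)⁻¹ * ∫⁻ ζ, ‖F ζ‖ₑ * ‖x - ζ‖ₑ⁻¹ := by
  unfold pot
  rw [enorm_mul]
  have h1 : ‖(((2 * Real.pi)⁻¹ : ℝ) : ℂ)‖ₑ = ENNReal.ofReal (2 * Real.pi)⁻¹ := by
    rw [← ofReal_norm, Complex.norm_real, Real.norm_eq_abs, abs_of_nonneg (by positivity)]
  rw [h1]
  gcongr
  refine (enorm_integral_le_lintegral_enorm _).trans ?_
  apply lintegral_mono
  intro ζ
  simp only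
  by_cases h0 : x - ζ = 0
  · simp [h0]
  rw [div_eq_mul_inv, enorm_mul, enorm_inv h0]
  gcongr
  rw [← ofReal_norm, ← ofReal_norm, Complex.norm_real]

lemma pot_int_aff (E : Set ℂ) (V : ℝ) (hV : 0 < V) (hE : volume E ≤ ENNReal.ofReal (V ^ 2))
    (F : ℂ → ℝ) (hF : Continuous F) (ε : ℝ) (hε : 0 ≤ ε)
    (hFε : ∫⁻ ζ, ‖F ζ‖ₑ ≤ ENNReal.ofReal ε) (x0 c : ℂ) (hc : c ≠ 0) :
    ∫⁻ ξ in E, ‖pot F (x0 + c * ξ) * c‖ₑ ≤ ENNReal.ofReal (2 * V * ε) := by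
  have hFm := hF.measurable
  have hb : ∀ ξ : ℂ, ‖pot F (x0 + c * ξ) * c‖ₑ ≤ ENNReal.ofReal (2 * Real.pi)⁻¹ *
      ∫⁻ ζ, ‖F ζ‖ₑ * ‖ξ - (ζ - x0) / c‖ₑ⁻¹ := by
    intro ξ
    rw [enorm_mul]
    calc _ ≤ (ENNReal.ofReal (2 * Real.pi)⁻¹ * ∫⁻ ζ, ‖F ζ‖ₑ * ‖x0 + c * ξ - ζ‖ₑ⁻¹) * ‖c‖ₑ := by
          gcongr; exact enorm_pot_le _ _
      _ = ENNReal.ofReal (2 * Real.pi)⁻¹ * ∫⁻ ζ, ‖F ζ‖ₑ * ‖x0 + c * ξ - ζ‖ₑ⁻¹ * ‖c‖ₑ := by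
          rw [mul_assoc, lintegral_mul_const _ (by fun_prop)]
      _ = _ := by
          congr 2
          ext ζ
          rw [mul_assoc]
          congr 1
          have : x0 + c * ξ - ζ = c * (ξ - (ζ - x0) / c) := by field_simp; ring
          have hc1 : ‖c‖ₑ ≠ 0 := by simpa using hc
          rw [this, enorm_mul, ENNReal.mul_inv (Or.inl hc1) (Or.inl enorm_ne_top), mul_right_comm,
            ENNReal.inv_mul_cancel hc1 enorm_ne_top, one_mul]
  refine (lintegral_mono hb).trans ?_
  rw [lintegral_const_mul _ (by
    apply Measurable.lintegral_prod_right'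
      (f := fun p : ℂ × ℂ => ‖F p.2‖ₑ * ‖p.1 - (p.2 - x0) / c‖ₑ⁻¹)
    fun_prop)]
  have := ker_tonelli E V hV hE F hFm ε hε hFε (fun ζ => (ζ - x0) / c) (by fun_prop)
  refine (mul_le_mul_right this _).trans ?_
  rw [← ENNReal.ofReal_mul (by positivity)]
  apply ENNReal.ofReal_le_ofReal
  have hpi := Real.pi_gt_three
  rw [inv_mul_le_iff₀ (by positivity)]
  have : 0 ≤ V * ε := by positivity
  nlinarith

lemma pot_int (E : Set ℂ) (V : ℝ) (hV : 0 < V) (hE : volume E ≤ ENNReal.ofReal (V ^ 2))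
    (F : ℂ → ℝ) (hF : Continuous F) (ε : ℝ) (hε : 0 ≤ ε)
    (hFε : ∫⁻ ζ, ‖F ζ‖ₑ ≤ ENNReal.ofReal ε) :
    ∫⁻ ξ in E, ‖pot F ξ‖ₑ ≤ ENNReal.ofReal (2 * V * ε) := by
  simpa using pot_int_aff E V hV hE F hF ε hε hFε 0 1 one_ne_zero

lemma F_int (u : ℂ → ℝ) (F : ℂ → ℝ) (ε : ℝ) (h0 : ∀ ζ, ζ ∉ ball (0:ℂ) 1 → F ζ = 0)
    (h1 : ∀ ζ, |F ζ| ≤ |lap u ζ|) (hcurv : curvIntE u (ball (0:ℂ) 1) ≤ ENNReal.ofReal ε) :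
    ∫⁻ ζ, ‖F ζ‖ₑ ≤ ENNReal.ofReal ε := by
  refine le_trans ?_ hcurv
  unfold curvIntE
  rw [← lintegral_indicator measurableSet_ball]
  apply lintegral_mono
  intro ζ
  by_cases hζ : ζ ∈ ball (0:ℂ) 1
  · simp only [Set.indicator_of_mem hζ]
    rw [← ofReal_norm]
    apply ENNReal.ofReal_le_ofReal
    rw [Real.norm_eq_abs]
    refine (h1 ζ).trans (le_of_eq ?_)
    unfold gauss
    rw [abs_mul, abs_neg, abs_of_pos (Real.exp_pos _), mul_right_comm, ← Real.exp_add]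
    simp
  · simp [h0 ζ hζ]

lemma eline (u : ℂ → ℝ) (hu : ContDiffOn ℝ (⊤ : ℕ∞) u (ball (0:ℂ) 1)) (x0 c p w : ℂ) (a b : ℝ)
    (hw : ‖w‖ = 1) (hin : ∀ s ∈ Set.Icc a b, x0 + c * (p + s * w) ∈ ball (0:ℂ) 1)
    (h : ∫⁻ s in Set.Icc a b, ‖gr u (x0 + c * (p + (s:ℂ) * w)) * c - 1‖ₑ ≤ 1)
    (s s' : ℝ) (hs : s ∈ Set.Icc a b) (hs' : s' ∈ Set.Icc a b) :
    |(u (x0 + c * (p + s * w)) - (p + s * w).re) -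
      (u (x0 + c * (p + s' * w)) - (p + s' * w).re)| ≤ 1 := by
  set f : ℝ → ℝ := fun s => u (x0 + c * (p + s * w)) - (p + s * w).re with hf
  set f' : ℝ → ℝ := fun s => ((gr u (x0 + c * (p + s * w)) * c - 1) * w).re with hf'
  have hder : ∀ s ∈ Set.Icc a b, HasDerivAt f (f' s) s := by
    intro s hs
    have hd : HasDerivAt (fun s : ℝ => p + (s:ℂ) * w) (1 * w) s :=
      ((Complex.ofRealCLM.hasDerivAt (x := s)).mul_const w).const_add p
    have h1 : HasDerivAt (fun s : ℝ => x0 + c * (p + (s:ℂ) * w)) (c * (1 * w)) s :=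
      (hd.const_mul c).const_add x0
    have h2 : HasFDerivAt u (fderiv ℝ u (x0 + c * (p + s * w))) (x0 + c * (p + s * w)) :=
      ((hu.contDiffAt (isOpen_ball.mem_nhds (hin s hs))).differentiableAt (by simp)).hasFDerivAt
    have h3 := h2.comp_hasDerivAt s h1
    have h4 := Complex.reCLM.hasFDerivAt.comp_hasDerivAt s hd
    refine (h3.sub h4).congr_deriv ?_
    rw [fderiv_eq_gr]
    simp only [hf', one_mul, Complex.reCLM_apply, ← Complex.sub_re]
    congr 1; ring
  have hcont : ContinuousOn f' (Set.Icc a b) := by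
    have : ContinuousOn (fun s : ℝ => gr u (x0 + c * (p + s * w))) (Set.Icc a b) := by
      intro s hs
      have h1 := (dbar_gr u _ (hu.contDiffAt (isOpen_ball.mem_nhds (hin s hs)))).1.continuousAt
      have h2 : ContinuousAt (fun s : ℝ => x0 + c * (p + (s:ℂ) * w)) s := by fun_prop
      exact (ContinuousAt.comp (f := fun s : ℝ => x0 + c * (p + (s:ℂ) * w)) h1 h2).continuousWithinAt
    exact Complex.continuous_re.comp_continuousOn (((this.mul continuousOn_const).sub
      continuousOn_const).mul continuousOn_const)
  have main : ∀ s s' : ℝ, s ∈ Set.Icc a b → s' ∈ Set.Icc a b → s ≤ s' → |f s' - f s| ≤ 1 := by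
    intro s s' hs hs' hss
    have hsub : Set.Icc s s' ⊆ Set.Icc a b := Set.Icc_subset_Icc hs.1 hs'.2
    have hftc : ∫ x in s..s', f' x = f s' - f s := by
      apply intervalIntegral.integral_eq_sub_of_hasDerivAt
      · intro x hx
        rw [Set.uIcc_of_le hss] at hx
        exact hder x (hsub hx)
      · apply ContinuousOn.intervalIntegrable
        rw [Set.uIcc_of_le hss]
        exact hcont.mono hsub
    rw [← hftc, intervalIntegral.integral_of_le hss]
    have h5 : ‖∫ x in Set.Ioc s s', f' x‖ₑ ≤ 1 := by
      refine (enorm_integral_le_lintegral_enorm _).trans (le_trans ?_ h)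
      refine (lintegral_mono_set (Set.Ioc_subset_Icc_self.trans hsub)).trans ?_
      apply lintegral_mono
      intro x
      simp only
      rw [← ofReal_norm, ← ofReal_norm]
      apply ENNReal.ofReal_le_ofReal
      rw [Real.norm_eq_abs]
      refine (Complex.abs_re_le_norm _).trans ?_
      rw [norm_mul, hw, mul_one]
    rw [← ofReal_norm, Real.norm_eq_abs] at h5
    simpa using h5
  rcases le_total s s' with hss | hss
  · rw [abs_sub_comm]; exact main s s' hs hs' hss
  · exact main s' s hs' hs hss

lemma path3 (u : ℂ → ℝ) (hu : ContDiffOn ℝ (⊤ : ℕ∞) u (ball (0:ℂ) 1)) (a d1 d2 d3 : ℂ)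
    (B1 B2 B3 : ℝ)
    (h1 : ∀ τ ∈ Set.Icc (0:ℝ) 1, a + τ * d1 ∈ ball (0:ℂ) 1 ∧ Real.exp (u (a + τ * d1)) ≤ B1)
    (h2 : ∀ τ ∈ Set.Icc (0:ℝ) 1, a + d1 + τ * d2 ∈ ball (0:ℂ) 1 ∧
      Real.exp (u (a + d1 + τ * d2)) ≤ B2)
    (h3 : ∀ τ ∈ Set.Icc (0:ℝ) 1, a + d1 + d2 + τ * d3 ∈ ball (0:ℂ) 1 ∧
      Real.exp (u (a + d1 + d2 + τ * d3)) ≤ B3) :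
    confDist u (ball (0:ℂ) 1) a (a + d1 + d2 + d3) ≤ B1 * ‖d1‖ + B2 * ‖d2‖ + B3 * ‖d3‖ := by
  set S : ℝ → ℝ := Real.smoothTransition with hS
  have hScd : ContDiff ℝ 1 S := Real.smoothTransition.contDiff (n := 1)
  have hSd : ∀ x, HasDerivAt S (deriv S x) x := fun x =>
    (hScd.differentiable (by norm_num) x).hasDerivAt
  have hS0 : ∀ x, x ≤ 0 → S x = 0 := fun x hx => Real.smoothTransition.zero_of_nonpos hx
  have hS1 : ∀ x, 1 ≤ x → S x = 1 := fun x hx => Real.smoothTransition.one_of_one_le hx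
  have hS01 : ∀ x, S x ∈ Set.Icc (0:ℝ) 1 := fun x =>
    ⟨Real.smoothTransition.nonneg x, Real.smoothTransition.le_one x⟩
  have hD0 : ∀ x, x ≤ 0 → deriv S x = 0 := fun x hx => by
    apply IsLocalMin.deriv_eq_zero
    exact Eventually.of_forall fun y => by rw [hS0 x hx]; exact (hS01 y).1
  have hD1 : ∀ x, 1 ≤ x → deriv S x = 0 := fun x hx => by
    apply IsLocalMax.deriv_eq_zero
    exact Eventually.of_forall fun y => by rw [hS1 x hx]; exact (hS01 y).2
  have hDn : ∀ x, 0 ≤ deriv S x := fun x => Real.smoothTransition.monotone.deriv_nonneg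
  have hDc : Continuous (deriv S) := hScd.continuous_deriv (by norm_num)
  set γ : ℝ → ℂ := fun τ => a + (S (3 * τ) : ℂ) * d1 + (S (3 * τ - 1) : ℂ) * d2
    + (S (3 * τ - 2) : ℂ) * d3 with hγ
  have hsd : ∀ (j τ : ℝ), HasDerivAt (fun τ => S (3 * τ - j)) (3 * deriv S (3 * τ - j)) τ := by
    intro j τ
    have hl : HasDerivAt (fun τ : ℝ => 3 * τ - j) 3 τ := by
      simpa using ((hasDerivAt_id τ).const_mul 3).sub_const j
    have := (hSd (3 * τ - j)).comp τ hl
    rw [mul_comm] at this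
    exact this
  have hγd : ∀ τ, HasDerivAt γ ((3 * deriv S (3 * τ) : ℝ) * d1 + (3 * deriv S (3 * τ - 1) : ℝ) * d2
      + (3 * deriv S (3 * τ - 2) : ℝ) * d3) τ := by
    intro τ
    have e0 := (hsd 0 τ).ofReal_comp.mul_const d1
    have e1 := (hsd 1 τ).ofReal_comp.mul_const d2
    have e2 := (hsd 2 τ).ofReal_comp.mul_const d3
    simp only [sub_zero] at e0
    exact ((e0.const_add a).add e1).add e2
  have hγc : ContDiff ℝ 1 γ := by
    have hh : ∀ j : ℝ, ContDiff ℝ 1 (fun τ : ℝ => (S (3 * τ - j) : ℂ)) := fun j =>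
      Complex.ofRealCLM.contDiff.comp (hScd.comp ((contDiff_const.mul contDiff_id).sub contDiff_const))
    have h00 := hh 0
    simp only [sub_zero] at h00
    exact ((contDiff_const.add (h00.mul contDiff_const)).add ((hh 1).mul contDiff_const)).add
      ((hh 2).mul contDiff_const)
  have hpt : ∀ τ ∈ Set.Icc (0:ℝ) 1, γ τ ∈ ball (0:ℂ) 1 ∧
      Real.exp (u (γ τ)) * ‖deriv γ τ‖ ≤ B1 * ‖d1‖ * (3 * deriv S (3 * τ - 0)) +
        B2 * ‖d2‖ * (3 * deriv S (3 * τ - 1)) + B3 * ‖d3‖ * (3 * deriv S (3 * τ - 2)) := by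
    intro τ hτ
    rw [(hγd τ).deriv]
    rcases le_total τ (1/3) with hA | hA
    · have g1 : γ τ = a + (S (3 * τ) : ℂ) * d1 := by
        simp only [hγ]; rw [hS0 (3 * τ - 1) (by linarith), hS0 (3 * τ - 2) (by linarith)]; simp
      rw [g1, hD0 (3 * τ - 1) (by linarith), hD0 (3 * τ - 2) (by linarith)]
      have := h1 _ (hS01 (3 * τ))
      refine ⟨this.1, ?_⟩
      simp only [mul_zero, Complex.ofReal_zero, zero_mul, add_zero, sub_zero]
      rw [norm_mul, Complex.norm_real, Real.norm_eq_abs, abs_of_nonneg (by linarith [hDn (3 * τ)])]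
      calc _ = Real.exp (u (a + (S (3 * τ) : ℂ) * d1)) * (3 * deriv S (3 * τ) * ‖d1‖) := rfl
        _ ≤ B1 * (3 * deriv S (3 * τ) * ‖d1‖) := by
          apply mul_le_mul_of_nonneg_right this.2
          have := hDn (3 * τ); positivity
        _ = _ := by ring
    rcases le_total τ (2/3) with hB | hB
    · have g1 : γ τ = a + d1 + (S (3 * τ - 1) : ℂ) * d2 := by
        simp only [hγ]; rw [hS1 (3 * τ) (by linarith), hS0 (3 * τ - 2) (by linarith)]; simp
      rw [g1, hD1 (3 * τ) (by linarith), hD0 (3 * τ - 2) (by linarith), hD1 (3 * τ - 0) (by linarith)]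
      have := h2 _ (hS01 (3 * τ - 1))
      refine ⟨this.1, ?_⟩
      simp only [mul_zero, Complex.ofReal_zero, zero_mul, add_zero, zero_add]
      rw [norm_mul, Complex.norm_real, Real.norm_eq_abs,
        abs_of_nonneg (by linarith [hDn (3 * τ - 1)])]
      calc _ = Real.exp (u (a + d1 + (S (3 * τ - 1) : ℂ) * d2)) *
            (3 * deriv S (3 * τ - 1) * ‖d2‖) := rfl
        _ ≤ B2 * (3 * deriv S (3 * τ - 1) * ‖d2‖) := by
          apply mul_le_mul_of_nonneg_right this.2
          have := hDn (3 * τ - 1); positivity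
        _ = _ := by ring
    · have g1 : γ τ = a + d1 + d2 + (S (3 * τ - 2) : ℂ) * d3 := by
        simp only [hγ]; rw [hS1 (3 * τ) (by linarith), hS1 (3 * τ - 1) (by linarith)]; simp
      rw [g1, hD1 (3 * τ) (by linarith), hD1 (3 * τ - 1) (by linarith), hD1 (3 * τ - 0) (by linarith)]
      have := h3 _ (hS01 (3 * τ - 2))
      refine ⟨this.1, ?_⟩
      simp only [mul_zero, Complex.ofReal_zero, zero_mul, add_zero, zero_add]
      rw [norm_mul, Complex.norm_real, Real.norm_eq_abs,
        abs_of_nonneg (by linarith [hDn (3 * τ - 2)])]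
      calc _ = Real.exp (u (a + d1 + d2 + (S (3 * τ - 2) : ℂ) * d3)) *
            (3 * deriv S (3 * τ - 2) * ‖d3‖) := rfl
        _ ≤ B3 * (3 * deriv S (3 * τ - 2) * ‖d3‖) := by
          apply mul_le_mul_of_nonneg_right this.2
          have := hDn (3 * τ - 2); positivity
        _ = _ := by ring
  have hmem : γ ∈ PathsIn (ball (0:ℂ) 1) a (a + d1 + d2 + d3) := by
    refine ⟨?_, ?_, fun t ht => (hpt t ht).1, hγc⟩
    · simp only [hγ]
      rw [hS0 (3 * 0) (by norm_num), hS0 (3 * 0 - 1) (by norm_num), hS0 (3 * 0 - 2) (by norm_num)]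
      simp
    · simp only [hγ]
      rw [hS1 (3 * 1) (by norm_num), hS1 (3 * 1 - 1) (by norm_num), hS1 (3 * 1 - 2) (by norm_num)]
      simp
  have hbdd : BddBelow (confLen u '' PathsIn (ball (0:ℂ) 1) a (a + d1 + d2 + d3)) := by
    refine ⟨0, ?_⟩
    rintro _ ⟨γ, _, rfl⟩
    exact intervalIntegral.integral_nonneg zero_le_one fun t _ => by positivity
  refine (csInf_le hbdd ⟨γ, hmem, rfl⟩).trans ?_
  have hIc : ∀ (K j : ℝ), Continuous (fun τ => K * (3 * deriv S (3 * τ - j))) := fun K j => by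
    fun_prop
  have hI : ∀ (K j : ℝ), 0 ≤ j → j ≤ 2 →
      ∫ τ in (0:ℝ)..1, K * (3 * deriv S (3 * τ - j)) = K := by
    intro K j hj0 hj2
    rw [intervalIntegral.integral_const_mul,
      intervalIntegral.integral_eq_sub_of_hasDerivAt (fun τ _ => hsd j τ)
        (by apply Continuous.intervalIntegrable; fun_prop),
      hS1 (3 * 1 - j) (by linarith), hS0 (3 * 0 - j) (by linarith)]
    ring
  have hle : confLen u γ ≤ ∫ τ in (0:ℝ)..1, (B1 * ‖d1‖ * (3 * deriv S (3 * τ - 0)) +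
        B2 * ‖d2‖ * (3 * deriv S (3 * τ - 1)) + B3 * ‖d3‖ * (3 * deriv S (3 * τ - 2))) := by
    apply intervalIntegral.integral_mono_on zero_le_one
    · apply ContinuousOn.intervalIntegrable
      rw [Set.uIcc_of_le zero_le_one]
      apply ContinuousOn.mul
      · apply Real.continuous_exp.comp_continuousOn
        exact hu.continuousOn.comp hγc.continuous.continuousOn fun t ht => (hpt t ht).1
      · exact (hγc.continuous_deriv (by norm_num)).norm.continuousOn
    · apply Continuous.intervalIntegrable
      exact ((hIc _ _).add (hIc _ _)).add (hIc _ _)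
    · exact fun t ht => (hpt t ht).2
  refine hle.trans (le_of_eq ?_)
  have hIc2 : ∀ K j K' j' : ℝ, Continuous (fun τ => K * (3 * deriv S (3 * τ - j)) +
      K' * (3 * deriv S (3 * τ - j'))) := fun K j K' j' => (hIc _ _).add (hIc _ _)
  rw [intervalIntegral.integral_add ((hIc2 _ _ _ _).intervalIntegrable _ _)
      ((hIc _ _).intervalIntegrable _ _),
    intervalIntegral.integral_add ((hIc _ _).intervalIntegrable _ _)
      ((hIc _ _).intervalIntegrable _ _),
    hI _ 0 (by norm_num) (by norm_num), hI _ 1 (by norm_num) (by norm_num),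
    hI _ 2 (by norm_num) (by norm_num)]

lemma sel (f : ℝ × ℝ → ℝ≥0∞) (L R : ℝ) (hL : 2 ≤ L) (hR : 1 ≤ R)
    (hf : ContinuousOn f (Set.Icc (-(2 * L)) 0 ×ˢ Set.Icc (-R) R))
    (h : ∫⁻ p in Set.Icc (-(2 * L)) 0 ×ˢ Set.Icc (-R) R, f p ≤ 1) :
    ∃ s ∈ Set.Icc (-(2 * L)) (-L), ∃ T ⊆ Set.Icc (-R) R, MeasurableSet T ∧
      ENNReal.ofReal R ≤ volume T ∧ (∫⁻ t in Set.Icc (-R) R, f (s, t) ≤ 1) ∧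
      ∀ t ∈ T, ∫⁻ s in Set.Icc (-(2 * L)) 0, f (s, t) ≤ 1 := by
  set S := Set.Icc (-(2 * L)) 0 ×ˢ Set.Icc (-R) R with hS
  have hSm : MeasurableSet S := measurableSet_Icc.prod measurableSet_Icc
  set G : ℝ × ℝ → ℝ≥0∞ := S.indicator f with hG
  have hGm : Measurable G := by
    have := hf.measurable_piecewise (g := fun _ => 0) continuousOn_const hSm
    convert this using 1
    rw [hG]
    exact (Set.piecewise_eq_indicator (s := S) (f := f)).symm
  have hGi : ∫⁻ p, G p ≤ 1 := by rwa [hG, lintegral_indicator hSm]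
  have hG1 : ∫⁻ s, ∫⁻ t, G (s, t) ≤ 1 := by
    rw [← lintegral_prod _ hGm.aemeasurable]; exact hGi
  have hG2 : ∫⁻ t, ∫⁻ s, G (s, t) ≤ 1 := by
    rw [← lintegral_prod_symm _ hGm.aemeasurable]; exact hGi
  have hGe : ∀ s ∈ Set.Icc (-(2 * L)) 0, ∀ t ∈ Set.Icc (-R) R, f (s, t) = G (s, t) :=
    fun s hs t ht => (Set.indicator_of_mem (show (s, t) ∈ S from ⟨hs, ht⟩) f).symm
  have ha : ∃ s ∈ Set.Icc (-(2 * L)) (-L), ∫⁻ t, G (s, t) ≤ 1 := by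
    by_contra! hcon
    have h1 : ∫⁻ s in Set.Icc (-(2 * L)) (-L), (1 : ℝ≥0∞) ≤ ∫⁻ s, ∫⁻ t, G (s, t) :=
      (setLIntegral_mono' measurableSet_Icc fun s hs => (hcon s hs).le).trans
        (setLIntegral_le_lintegral _ _)
    rw [setLIntegral_one, Real.volume_Icc] at h1
    have h2 := h1.trans hG1
    rw [ENNReal.ofReal_le_one] at h2
    linarith
  obtain ⟨s, hs, hs1⟩ := ha
  have hm : Measurable fun t => ∫⁻ s, G (s, t) := hGm.lintegral_prod_left'
  refine ⟨s, hs, Set.Icc (-R) R ∩ {t | ∫⁻ s, G (s, t) < 1}, Set.inter_subset_left,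
    measurableSet_Icc.inter (measurableSet_lt hm measurable_const), ?_, ?_, ?_⟩
  · have hb : volume {t | 1 ≤ ∫⁻ s, G (s, t)} ≤ 1 := by
      have := mul_meas_ge_le_lintegral (μ := volume) hm 1
      rw [one_mul] at this
      exact this.trans hG2
    have hc : volume (Set.Icc (-R) R) ≤
        volume (Set.Icc (-R) R ∩ {t | ∫⁻ s, G (s, t) < 1}) + 1 := by
      refine (measure_mono (t := (Set.Icc (-R) R ∩ {t | ∫⁻ s, G (s, t) < 1}) ∪
        {t | 1 ≤ ∫⁻ s, G (s, t)}) ?_).trans ((measure_union_le _ _).trans (add_le_add_right hb _))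
      intro t ht
      rcases lt_or_ge (∫⁻ s, G (s, t)) 1 with h | h
      · exact Or.inl ⟨ht, h⟩
      · exact Or.inr h
    rw [Real.volume_Icc] at hc
    have : ENNReal.ofReal R + 1 ≤ volume (Set.Icc (-R) R ∩ {t | ∫⁻ s, G (s, t) < 1}) + 1 := by
      refine le_trans ?_ hc
      rw [← ENNReal.ofReal_one, ← ENNReal.ofReal_add (by linarith) zero_le_one]
      exact ENNReal.ofReal_le_ofReal (by linarith)
    exact (ENNReal.add_le_add_iff_right ENNReal.one_ne_top).1 this
  · rw [setLIntegral_congr_fun measurableSet_Icc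
      (fun t ht => hGe s ⟨hs.1, hs.2.trans (by linarith)⟩ t ht)]
    exact (setLIntegral_le_lintegral _ _).trans hs1
  · intro t ht
    rw [setLIntegral_congr_fun measurableSet_Icc (fun s hs => hGe s hs t ht.1)]
    exact (setLIntegral_le_lintegral _ _).trans ht.2.le

lemma geom (Λ₁ L R : ℝ) (hL : 2 ≤ L) (hR : 1 ≤ R) (hRL : 2 * R ≤ Real.exp L)
    (hbig : Λ₁ * Real.pi * Real.exp 10 * (4 * L + 2) ^ 2 ≤ R)
    (u : ℂ → ℝ) (hu : ContDiffOn ℝ (⊤ : ℕ∞) u (ball (0:ℂ) 1))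
    (harea : ∀ r : ℝ, 0 < r → ∀ z ∈ ball (0:ℂ) (3/4),
                confAreaE u (confBall u (ball (0:ℂ) 1) z r)
                  < ENNReal.ofReal (Λ₁ * (Real.pi * r ^ 2)))
    (x0 c : ℂ) (hc : c ≠ 0)
    (hQ : ∀ ξ ∈ Set.Icc (-(2 * L)) 0 ×ℂ Set.Icc (-R) R, x0 + c * ξ ∈ ball (0:ℂ) (3/4))
    (hint : ∫⁻ ξ in Set.Icc (-(2 * L)) 0 ×ℂ Set.Icc (-R) R, ‖gr u (x0 + c * ξ) * c - 1‖ₑ ≤ 1) :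
    False := by
  have hQ' : ∀ s ∈ Set.Icc (-(2 * L)) 0, ∀ t ∈ Set.Icc (-R) R,
      x0 + c * ((s:ℂ) + t * Complex.I) ∈ ball (0:ℂ) (3/4) := by
    intro s hs t ht
    apply hQ
    rw [Complex.mem_reProdIm]
    simpa using ⟨hs, ht⟩
  have h34 : ball (0:ℂ) (3/4) ⊆ ball (0:ℂ) 1 := ball_subset_ball (by norm_num)
  have hint2 : ∫⁻ p in Set.Icc (-(2 * L)) 0 ×ˢ Set.Icc (-R) R,
      ‖gr u (x0 + c * ((p.1:ℂ) + p.2 * Complex.I)) * c - 1‖ₑ ≤ 1 := by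
    refine le_trans (le_of_eq ?_) hint
    rw [← (Complex.volume_preserving_equiv_real_prod.symm).setLIntegral_comp_preimage_emb
      (MeasurableEquiv.measurableEmbedding _)]
    have : (Complex.measurableEquivRealProd.symm ⁻¹' (Set.Icc (-(2 * L)) 0 ×ℂ Set.Icc (-R) R))
        = Set.Icc (-(2 * L)) 0 ×ˢ Set.Icc (-R) R := by
      ext p; simp [Complex.mem_reProdIm, Complex.measurableEquivRealProd, -Set.Icc_prod_Icc]
    rw [this]
    congr 1
    ext p
    rw [← Complex.mk_eq_add_mul_I]
    rfl
  have hgrc : ∀ z ∈ ball (0:ℂ) 1, ContinuousAt (gr u) z := fun z hz =>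
    (dbar_gr u z (hu.contDiffAt (isOpen_ball.mem_nhds hz))).1.continuousAt
  obtain ⟨sS, hsS, T, hTs, hTm, hTv, hv, hh⟩ := sel _ L R hL hR (by
    intro p hp
    apply ContinuousAt.continuousWithinAt
    apply ContinuousAt.enorm
    apply ContinuousAt.sub _ continuousAt_const
    apply ContinuousAt.mul _ continuousAt_const
    refine ContinuousAt.comp (g := gr u)
      (f := fun p : ℝ × ℝ => x0 + c * ((p.1:ℂ) + p.2 * Complex.I)) ?_ (by fun_prop)
    exact hgrc _ (h34 (hQ' _ hp.1 _ hp.2))) hint2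
  set e : ℝ → ℝ → ℝ := fun s t => u (x0 + c * ((s:ℂ) + t * Complex.I)) - s with he
  have hsS' : sS ∈ Set.Icc (-(2 * L)) 0 := ⟨hsS.1, hsS.2.trans (by linarith)⟩
  set k := e sS 0 with hk
  have hver : ∀ t ∈ Set.Icc (-R) R, |e sS t - k| ≤ 1 := by
    intro t ht
    have := eline u hu x0 c sS Complex.I (-R) R (by simp) (fun t ht => h34 (hQ' _ hsS' t ht)) hv t 0
      ht ⟨by linarith, by linarith⟩
    simpa [hk, he] using this
  have hhor : ∀ t ∈ T, ∀ s ∈ Set.Icc (-(2 * L)) 0, |e s t - k| ≤ 2 := by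
    intro t ht s hs
    have hsw : ∀ s : ℝ, (t:ℂ) * Complex.I + (s:ℂ) * 1 = (s:ℂ) + t * Complex.I := fun s => by ring
    have := eline u hu x0 c (t * Complex.I) 1 (-(2 * L)) 0 (by simp)
      (fun s hs => by rw [hsw]; exact h34 (hQ' s hs _ (hTs ht)))
      (by simp only [hsw]; exact hh t ht) s sS hs hsS'
    simp only [hsw] at this
    have h1 := hver t (hTs ht)
    have h2 : |e s t - e sS t| ≤ 1 := by simpa [he] using this
    have : e s t - k = (e s t - e sS t) + (e sS t - k) := by ring
    rw [this]
    exact (abs_add_le _ _).trans (by linarith)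
  have hTne : T.Nonempty := by
    rw [Set.nonempty_iff_ne_empty]
    rintro rfl
    rw [measure_empty] at hTv
    have := ENNReal.ofReal_pos.2 (by linarith : 0 < R)
    exact absurd hTv (not_le.2 this)
  obtain ⟨t1, ht1⟩ := hTne
  set r := ‖c‖ * Real.exp (k + 2) * (4 * L + 2) with hr
  have hcp : 0 < ‖c‖ := norm_pos_iff.2 hc
  have hrp : 0 < r := by positivity
  set z := x0 + c * ((0:ℝ) + t1 * Complex.I) with hz
  have hzm : z ∈ ball (0:ℂ) (3/4) := hQ' 0 ⟨by linarith, le_rfl⟩ t1 (hTs ht1)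
  have hdist : ∀ s ∈ Set.Icc (-1:ℝ) 0, ∀ t2 ∈ T,
      x0 + c * ((s:ℂ) + t2 * Complex.I) ∈ confBall u (ball (0:ℂ) 1) z r := by
    intro s hs t2 ht2
    have hs' : s ∈ Set.Icc (-(2 * L)) 0 := ⟨by linarith [hs.1], hs.2⟩
    refine ⟨h34 (hQ' s hs' _ (hTs ht2)), ?_⟩
    have hp := path3 u hu z (c * sS) (c * (((t2 - t1 : ℝ):ℂ) * Complex.I)) (c * ((s - sS : ℝ):ℂ))
      (Real.exp (k + 2)) (Real.exp (k + 1 - L)) (Real.exp (k + 2)) ?_ ?_ ?_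
    · have e1 : z + c * sS + c * (((t2 - t1 : ℝ):ℂ) * Complex.I) + c * ((s - sS : ℝ):ℂ)
          = x0 + c * ((s:ℂ) + t2 * Complex.I) := by
        rw [hz]; push_cast; ring
      rw [e1] at hp
      refine hp.trans_lt ?_
      simp only [norm_mul, Complex.norm_real, Complex.norm_I, mul_one, Real.norm_eq_abs]
      have b1 : |sS| ≤ 2 * L := by rw [abs_le]; constructor <;> linarith [hsS.1, hsS'.2]
      have b2 : |t2 - t1| ≤ 2 * R := by
        have := hTs ht1; have := hTs ht2
        rw [abs_le]; constructor <;> linarith [(hTs ht1).1, (hTs ht1).2, (hTs ht2).1, (hTs ht2).2]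
      have b3 : |s - sS| ≤ 2 * L := by
        rw [abs_le]; constructor <;> linarith [hsS.1, hsS.2, hs.1, hs.2]
      have b4 : Real.exp (k + 1 - L) * (2 * R) ≤ Real.exp (k + 1) := by
        calc _ ≤ Real.exp (k + 1 - L) * Real.exp L := by gcongr
          _ = _ := by rw [← Real.exp_add]; congr 1; ring
      have b5 : Real.exp (k + 1) < Real.exp (k + 2) := Real.exp_lt_exp.2 (by linarith)
      calc _ ≤ Real.exp (k + 2) * (‖c‖ * (2 * L)) + Real.exp (k + 1 - L) * (‖c‖ * (2 * R)) +
            Real.exp (k + 2) * (‖c‖ * (2 * L)) := by gcongr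
        _ = ‖c‖ * (Real.exp (k + 2) * (4 * L) + Real.exp (k + 1 - L) * (2 * R)) := by ring
        _ < ‖c‖ * (Real.exp (k + 2) * (4 * L) + Real.exp (k + 2) * 2) := by
          apply mul_lt_mul_of_pos_left _ hcp
          have := Real.exp_pos (k + 2)
          linarith
        _ = r := by rw [hr]; ring
    · intro τ hτ
      have e1 : z + τ * (c * sS) = x0 + c * (((τ * sS : ℝ):ℂ) + t1 * Complex.I) := by
        rw [hz]; push_cast; ring
      have m : τ * sS ∈ Set.Icc (-(2 * L)) 0 := by
        constructor <;> nlinarith [hτ.1, hτ.2, hsS.1, hsS'.2]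
      rw [e1]
      refine ⟨h34 (hQ' _ m _ (hTs ht1)), Real.exp_le_exp.2 ?_⟩
      have := (abs_le.1 (hhor t1 ht1 _ m)).2
      simp only [he] at this
      linarith [m.2]
    · intro τ hτ
      have e1 : z + c * sS + τ * (c * (((t2 - t1 : ℝ):ℂ) * Complex.I))
          = x0 + c * ((sS:ℂ) + ((t1 + τ * (t2 - t1) : ℝ):ℂ) * Complex.I) := by
        rw [hz]; push_cast; ring
      have m : t1 + τ * (t2 - t1) ∈ Set.Icc (-R) R := by
        have h1 := hTs ht1; have h2 := hTs ht2
        constructor <;> nlinarith [hτ.1, hτ.2, h1.1, h1.2, h2.1, h2.2]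
      rw [e1]
      refine ⟨h34 (hQ' _ hsS' _ m), Real.exp_le_exp.2 ?_⟩
      have := (abs_le.1 (hver _ m)).2
      simp only [he] at this
      linarith [hsS.2]
    · intro τ hτ
      have e1 : z + c * sS + c * (((t2 - t1 : ℝ):ℂ) * Complex.I) + τ * (c * ((s - sS : ℝ):ℂ))
          = x0 + c * (((sS + τ * (s - sS) : ℝ):ℂ) + t2 * Complex.I) := by
        rw [hz]; push_cast; ring
      have m : sS + τ * (s - sS) ∈ Set.Icc (-(2 * L)) 0 := by
        constructor <;> nlinarith [hτ.1, hτ.2, hs'.1, hs'.2, hsS'.1, hsS'.2]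
      rw [e1]
      refine ⟨h34 (hQ' _ m _ (hTs ht2)), Real.exp_le_exp.2 ?_⟩
      have := (abs_le.1 (hhor _ ht2 _ m)).2
      simp only [he] at this
      linarith [m.2]
  -- area bound
  set A : Set ℂ := Set.Icc (-1:ℝ) 0 ×ℂ T with hA
  have hAm : MeasurableSet A := by
    rw [hA]
    exact (Complex.measurable_re measurableSet_Icc).inter (Complex.measurable_im hTm)
  have hAv : volume A = volume T := by
    rw [← Complex.volume_preserving_equiv_real_prod.symm.measure_preimage_equiv]
    have : (Complex.measurableEquivRealProd.symm ⁻¹' A) = Set.Icc (-1:ℝ) 0 ×ˢ T := by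
      ext p; simp [hA, Complex.mem_reProdIm, Complex.measurableEquivRealProd]
    rw [this, Measure.volume_eq_prod, Measure.prod_prod, Real.volume_Icc]
    simp
  set f : ℂ → ℂ := fun ξ => x0 + c * ξ with hf
  have hinj : Function.Injective f := fun a b hab => by
    simp only [hf] at hab
    exact mul_left_cancel₀ hc (add_left_cancel hab)
  have hfa : f '' A = (fun z => x0 + z) '' ((LinearMap.mulLeft ℝ c) '' A) := by
    rw [Set.image_image]; rfl
  have himv : volume (f '' A) = ENNReal.ofReal (‖c‖ ^ 2) * volume T := by
    rw [hfa, Set.image_add_left, measure_preimage_add, Measure.addHaar_image_linearMap, hAv]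
    congr 2
    have : LinearMap.det (LinearMap.mulLeft ℝ c) = Algebra.norm ℝ c := by
      rw [Algebra.norm_apply]; rfl
    rw [this, Algebra.norm_complex_apply, Complex.normSq_eq_norm_sq, abs_of_nonneg (by positivity)]
  have himm : MeasurableSet (f '' A) := by
    have hfc : Continuous f := by fun_prop
    exact hfc.measurableEmbedding hinj |>.measurableSet_image.2 hAm
  have hfin := harea r hrp z hzm
  have hlow : ENNReal.ofReal (Real.exp (2 * (k - 3))) * (ENNReal.ofReal (‖c‖ ^ 2) * volume T)
      ≤ confAreaE u (confBall u (ball (0:ℂ) 1) z r) := by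
    have hsub : f '' A ⊆ confBall u (ball (0:ℂ) 1) z r := by
      rintro _ ⟨ξ, hξ, rfl⟩
      rw [hA, Complex.mem_reProdIm] at hξ
      have := hdist _ hξ.1 _ hξ.2
      rwa [Complex.re_add_im] at this
    unfold confAreaE
    refine le_trans ?_ (lintegral_mono_set hsub)
    rw [← himv, ← setLIntegral_const]
    apply setLIntegral_mono' himm
    rintro _ ⟨ξ, hξ, rfl⟩
    rw [hA, Complex.mem_reProdIm] at hξ
    have := (abs_le.1 (hhor _ hξ.2 _ ⟨by linarith [hξ.1.1], hξ.1.2⟩)).1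
    simp only [he] at this
    rw [Complex.re_add_im] at this
    apply ENNReal.ofReal_le_ofReal
    apply Real.exp_le_exp.2
    simp only [hf]
    linarith [hξ.1.1]
  have hlow2 : ENNReal.ofReal (Real.exp (2 * (k - 3)) * (‖c‖ ^ 2 * R))
      ≤ confAreaE u (confBall u (ball (0:ℂ) 1) z r) := by
    refine le_trans ?_ hlow
    rw [ENNReal.ofReal_mul (by positivity), ENNReal.ofReal_mul (by positivity)]
    gcongr
  have hlt := hlow2.trans_lt hfin
  have hlt2 := (ENNReal.ofReal_lt_ofReal_iff_of_nonneg (by positivity)).1 hlt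
  have hcalc : Λ₁ * (Real.pi * r ^ 2) ≤ Real.exp (2 * (k - 3)) * (‖c‖ ^ 2 * R) := by
    have e1 : Real.exp (k + 2) ^ 2 = Real.exp (2 * (k - 3)) * Real.exp 10 := by
      rw [← Real.exp_add, ← Real.exp_nat_mul]; congr 1; push_cast; ring
    calc Λ₁ * (Real.pi * r ^ 2) = Real.exp (k + 2) ^ 2 * ‖c‖ ^ 2 * (Λ₁ * Real.pi * (4 * L + 2) ^ 2) := by
          rw [hr]; ring
      _ = Real.exp (2 * (k - 3)) * (‖c‖ ^ 2 * (Λ₁ * Real.pi * Real.exp 10 * (4 * L + 2) ^ 2)) := by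
          rw [e1]; ring
      _ ≤ _ := by gcongr
  linarith

lemma params (Λ₁ : ℝ) (hΛ : 0 < Λ₁) : ∃ L R : ℝ, 2 ≤ L ∧ 1 ≤ R ∧ 2 * R ≤ Real.exp L ∧
    Λ₁ * Real.pi * Real.exp 10 * (4 * L + 2) ^ 2 ≤ R := by
  have h := (Real.tendsto_exp_div_pow_atTop 2).eventually_ge_atTop
    (2 * (Λ₁ * Real.pi * Real.exp 10 * 25))
  obtain ⟨L, hL1, hL2⟩ := (h.and (eventually_ge_atTop 2)).exists
  refine ⟨L, Real.exp L / 2, hL2, ?_, by linarith, ?_⟩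
  · linarith [Real.add_one_le_exp L]
  · rw [le_div_iff₀ (by positivity)] at hL1
    have : (4 * L + 2) ^ 2 ≤ 25 * L ^ 2 := by nlinarith
    calc _ ≤ Λ₁ * Real.pi * Real.exp 10 * (25 * L ^ 2) := by gcongr
      _ ≤ _ := by linarith

lemma vol_Q (L R : ℝ) (hL : 2 ≤ L) (hR : 1 ≤ R) :
    volume (Set.Icc (-(2 * L)) 0 ×ℂ Set.Icc (-R) R) = ENNReal.ofReal (4 * L * R) := by
  rw [← Complex.volume_preserving_equiv_real_prod.symm.measure_preimage_equiv]
  have : (Complex.measurableEquivRealProd.symm ⁻¹' (Set.Icc (-(2 * L)) 0 ×ℂ Set.Icc (-R) R))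
      = Set.Icc (-(2 * L)) 0 ×ˢ Set.Icc (-R) R := by
    ext p; simp [Complex.mem_reProdIm, Complex.measurableEquivRealProd, -Set.Icc_prod_Icc]
  rw [this, Measure.volume_eq_prod, Measure.prod_prod, Real.volume_Icc, Real.volume_Icc,
    ← ENNReal.ofReal_mul (by linarith)]
  congr 1; ring

lemma H_bound (Λ₁ L R : ℝ) (hL : 2 ≤ L) (hR : 1 ≤ R) (hRL : 2 * R ≤ Real.exp L)
    (hbig : Λ₁ * Real.pi * Real.exp 10 * (4 * L + 2) ^ 2 ≤ R)
    (u : ℂ → ℝ) (hu : ContDiffOn ℝ (⊤ : ℕ∞) u (ball (0:ℂ) 1))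
    (harea : ∀ r : ℝ, 0 < r → ∀ z ∈ ball (0:ℂ) (3/4),
                confAreaE u (confBall u (ball (0:ℂ) 1) z r)
                  < ENNReal.ofReal (Λ₁ * (Real.pi * r ^ 2)))
    (F : ℂ → ℝ) (hF : Continuous F) (H : ℂ → ℂ) (hH : DifferentiableOn ℂ H (ball 0 (7/8)))
    (hdec : ∀ z ∈ ball (0:ℂ) (7/8), gr u z = H z + pot F z) (ε : ℝ) (hε : 0 ≤ ε)
    (hε2 : 16 * L * R * ε ≤ 1) (hFε : ∫⁻ ζ, ‖F ζ‖ₑ ≤ ENNReal.ofReal ε) :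
    ∀ z ∈ closedBall (0:ℂ) (3/4), (3/4 - ‖z‖) * ‖H z‖ ≤
      2 * (2 * L + R) + 1 + 64 * L * R * (2 * L + R) := by
  set R' := 2 * L + R with hR'
  set M0 := 2 * R' + 1 + 64 * L * R * R' with hM0
  have hR'p : 0 < R' := by positivity
  have hLR : 0 < L * R := by positivity
  have hcb : closedBall (0:ℂ) (3/4) ⊆ ball 0 (7/8) := closedBall_subset_ball (by norm_num)
  have hcont : ContinuousOn (fun z => (3/4 - ‖z‖) * ‖H z‖) (closedBall (0:ℂ) (3/4)) := by
    apply ContinuousOn.mul (by fun_prop)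
    exact (hH.continuousOn.mono hcb).norm
  obtain ⟨x0, hx0, hmax⟩ := (isCompact_closedBall (0:ℂ) (3/4)).exists_isMaxOn
    ⟨0, by simp; norm_num⟩ hcont
  intro z hz
  refine (hmax hz).trans ?_
  simp only
  by_contra! hcon
  have hM0p : 0 < M0 := by positivity
  have hx0n : ‖x0‖ ≤ 3/4 := by simpa using hx0
  set N := ‖H x0‖ with hN
  have hNn : 0 ≤ N := norm_nonneg _
  have hprod : 0 < (3/4 - ‖x0‖) * N := hM0p.trans hcon
  have hNp : 0 < N := by
    rcases hNn.eq_or_lt with h | h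
    · rw [← h] at hprod; simp at hprod
    · exact h
  have hσ0 : 0 < 3/4 - ‖x0‖ := pos_of_mul_pos_left hprod hNn
  set σ := (3/4 - ‖x0‖) / 2 with hσ
  have hσp : 0 < σ := by positivity
  have hσN : M0 / 2 < σ * N := by rw [hσ]; linarith
  have hσb : ball x0 σ ⊆ ball (0:ℂ) (3/4) := by
    apply ball_subset_ball'
    rw [dist_zero_right]; linarith
  have hHb : ∀ z ∈ ball x0 σ, ‖H z‖ ≤ 2 * N := by
    intro z hz
    have h1 : (3/4 - ‖z‖) * ‖H z‖ ≤ (3/4 - ‖x0‖) * N := hmax (ball_subset_closedBall (hσb hz))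
    have h2 : ‖z‖ ≤ ‖x0‖ + σ := by
      have : ‖z - x0‖ < σ := by simpa [dist_eq_norm] using hz
      have := norm_sub_norm_le z x0
      linarith
    have h3 : σ * ‖H z‖ ≤ (3/4 - ‖z‖) * ‖H z‖ := by
      apply mul_le_mul_of_nonneg_right _ (norm_nonneg _); linarith
    have h4 : σ * ‖H z‖ ≤ σ * (2 * N) := by
      have : 3/4 - ‖x0‖ = 2 * σ := by rw [hσ]; ring
      rw [this] at h1; linarith
    exact le_of_mul_le_mul_left h4 hσp
  have hlip : ∀ z ∈ ball x0 σ, dist (H z) (H x0) ≤ 4 * N / σ * dist z x0 := by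
    intro z hz
    refine Complex.dist_le_div_mul_dist_of_mapsTo_ball
      (hH.mono (hσb.trans (ball_subset_closedBall.trans hcb))) ?_ hz
    intro w hw
    rw [mem_closedBall, dist_eq_norm]
    have h1 := hHb w hw
    have h2 := norm_sub_le (H w) (H x0)
    linarith
  have hHx0 : H x0 ≠ 0 := norm_pos_iff.1 hNp
  set c := (H x0)⁻¹ with hc
  have hcn : ‖c‖ = N⁻¹ := by rw [hc, norm_inv]
  have hQn : ∀ ξ ∈ Set.Icc (-(2 * L)) 0 ×ℂ Set.Icc (-R) R, ‖c * ξ‖ ≤ R' / N := by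
    intro ξ hξ
    rw [Complex.mem_reProdIm] at hξ
    rw [norm_mul, hcn, inv_mul_eq_div]
    gcongr
    refine (Complex.norm_le_abs_re_add_abs_im ξ).trans ?_
    have h1 : |ξ.re| ≤ 2 * L := by rw [abs_le]; constructor <;> linarith [hξ.1.1, hξ.1.2]
    have h2 : |ξ.im| ≤ R := abs_le.2 hξ.2
    linarith
  have hRN : R' / N < σ := by
    rw [div_lt_iff₀ hNp]
    have : 0 < 64 * L * R * R' := by positivity
    linarith
  have hQb : ∀ ξ ∈ Set.Icc (-(2 * L)) 0 ×ℂ Set.Icc (-R) R, x0 + c * ξ ∈ ball x0 σ := by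
    intro ξ hξ
    rw [mem_ball, dist_eq_norm, add_sub_cancel_left]
    exact (hQn ξ hξ).trans_lt hRN
  refine geom Λ₁ L R hL hR hRL hbig u hu harea x0 c (inv_ne_zero hHx0)
    (fun ξ hξ => hσb (hQb ξ hξ)) ?_
  have hpt : ∀ ξ ∈ Set.Icc (-(2 * L)) 0 ×ℂ Set.Icc (-R) R,
      ‖gr u (x0 + c * ξ) * c - 1‖ₑ ≤ ENNReal.ofReal (8 * R' / M0) + ‖pot F (x0 + c * ξ) * c‖ₑ := by
    intro ξ hξ
    have hb := hQb ξ hξ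
    rw [hdec _ (hcb (ball_subset_closedBall (hσb hb)))]
    have e1 : (H (x0 + c * ξ) + pot F (x0 + c * ξ)) * c - 1 =
        (H (x0 + c * ξ) - H x0) * c + pot F (x0 + c * ξ) * c := by
      have : H x0 * c = 1 := mul_inv_cancel₀ hHx0
      linear_combination (1 : ℂ) * this
    rw [e1]
    refine (enorm_add_le _ _).trans (add_le_add_left ?_ _)
    rw [← ofReal_norm]
    apply ENNReal.ofReal_le_ofReal
    rw [norm_mul, hcn, ← dist_eq_norm]
    have h1 := hlip _ hb
    rw [dist_eq_norm (x0 + c * ξ), add_sub_cancel_left] at h1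
    have h2 := hQn ξ hξ
    calc _ ≤ (4 * N / σ * (R' / N)) * N⁻¹ := by
          gcongr; exact h1.trans (by gcongr)
      _ = 4 * R' / (σ * N) := by field_simp
      _ ≤ 4 * R' / (M0 / 2) := by gcongr
      _ = _ := by field_simp; ring
  have hQm : MeasurableSet (Set.Icc (-(2 * L)) 0 ×ℂ Set.Icc (-R) R) :=
    (Complex.measurable_re measurableSet_Icc).inter (Complex.measurable_im measurableSet_Icc)
  refine (setLIntegral_mono' hQm hpt).trans ?_
  rw [lintegral_add_left measurable_const, setLIntegral_const, vol_Q L R hL hR,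
    ← ENNReal.ofReal_mul (by positivity)]
  have hp := pot_int_aff (Set.Icc (-(2 * L)) 0 ×ℂ Set.Icc (-R) R) (4 * L * R) (by positivity)
    (by rw [vol_Q L R hL hR]; apply ENNReal.ofReal_le_ofReal; nlinarith [mul_le_mul hL hR zero_le_one (by linarith)]) F hF ε hε hFε x0 c
    (inv_ne_zero hHx0)
  refine (add_le_add_right hp _).trans ?_
  rw [← ENNReal.ofReal_add (by positivity) (by positivity)]
  rw [ENNReal.ofReal_le_one]
  have h1 : 8 * R' / M0 * (4 * L * R) ≤ 1/2 := by
    rw [div_mul_eq_mul_div, div_le_iff₀ hM0p, hM0]; nlinarith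
  linarith

lemma H_bound' (H : ℂ → ℂ) (M0 : ℝ) (h : ∀ z ∈ closedBall (0:ℂ) (3/4), (3/4 - ‖z‖) * ‖H z‖ ≤ M0) :
    ∀ z ∈ ball (0:ℂ) (1/2), ‖H z‖ ≤ 4 * M0 := by
  intro z hz
  have h1 := h z (ball_subset_closedBall (ball_subset_ball (by norm_num) hz))
  have h2 : ‖z‖ < 1/2 := by simpa using hz
  nlinarith [norm_nonneg (H z)]

lemma vol_half : volume (ball (0:ℂ) (1/2)) = ENNReal.ofReal (Real.pi / 4) := by
  rw [Complex.volume_ball, ← ENNReal.ofReal_pow (by norm_num)]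
  have : (NNReal.pi : ℝ≥0∞) = ENNReal.ofReal Real.pi := by
    rw [← NNReal.coe_real_pi, ENNReal.ofReal_coe_nnreal]
  rw [this, ← ENNReal.ofReal_mul (by norm_num)]
  congr 1; ring

lemma vol_half_le : volume (ball (0:ℂ) (1/2)) ≤ 1 := by
  rw [vol_half, ENNReal.ofReal_le_one]; linarith [Real.pi_le_four]

lemma weakL2 (u : ℂ → ℝ) (F : ℂ → ℝ) (hF : Continuous F) (H : ℂ → ℂ)
    (hdec : ∀ z ∈ ball (0:ℂ) (7/8), gr u z = H z + pot F z) (ε : ℝ) (hε : 0 ≤ ε)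
    (hε2 : ε ≤ 1) (hFε : ∫⁻ ζ, ‖F ζ‖ₑ ≤ ENNReal.ofReal ε) (CH : ℝ) (hCH : 0 ≤ CH)
    (hHb : ∀ z ∈ ball (0:ℂ) (1/2), ‖H z‖ ≤ CH) :
    wL2Bound (fun x => ‖fderiv ℝ u x‖) (ball (0:ℂ) (1/2)) (CH + 2) := by
  intro t ht
  set E := {x ∈ ball (0:ℂ) (1/2) | t < |‖fderiv ℝ u x‖|} with hE
  have hEm : MeasurableSet E := by
    apply measurableSet_ball.inter
    exact measurableSet_lt measurable_const ((measurable_fderiv ℝ u).norm.abs)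
  have hEs : E ⊆ ball (0:ℂ) (1/2) := fun x hx => hx.1
  have hE1 : volume E ≤ 1 := (measure_mono hEs).trans vol_half_le
  have hEt : volume E ≠ ∞ := ne_top_of_le_ne_top ENNReal.one_ne_top hE1
  set m := (volume E).toReal with hm
  have hm1 : m ≤ 1 := by
    have := ENNReal.toReal_mono ENNReal.one_ne_top hE1
    simpa using this
  have hm0 : 0 ≤ m := ENNReal.toReal_nonneg
  rw [← Real.sqrt_eq_rpow]
  set V := Real.sqrt m with hV
  rcases hm0.eq_or_lt with h | hmp
  · rw [hV, ← h]; simp; linarith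
  have hVp : 0 < V := Real.sqrt_pos.2 hmp
  have hV1 : V ≤ 1 := by rw [hV]; exact Real.sqrt_le_one.2 hm1
  have hV2 : V ^ 2 = m := Real.sq_sqrt hm0
  have hEV : volume E = ENNReal.ofReal (V ^ 2) := by rw [hV2, hm, ENNReal.ofReal_toReal hEt]
  have h1 : ENNReal.ofReal t * volume E ≤ ∫⁻ x in E, (ENNReal.ofReal CH + ‖pot F x‖ₑ) := by
    rw [← setLIntegral_const]
    apply setLIntegral_mono' hEm
    intro x hx
    have h2 : t < ‖fderiv ℝ u x‖ := by have := hx.2; rwa [abs_norm] at this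
    have h3 := h2.le.trans (norm_fderiv_le_gr u x)
    rw [hdec x (ball_subset_ball (by norm_num) hx.1)] at h3
    have h4 := h3.trans (norm_add_le _ _)
    rw [← ofReal_norm, ← ENNReal.ofReal_add hCH (norm_nonneg _)]
    exact ENNReal.ofReal_le_ofReal (h4.trans (by linarith [hHb x hx.1]))
  rw [lintegral_add_left measurable_const, setLIntegral_const] at h1
  have h2 := h1.trans (add_le_add_right (pot_int E V hVp hEV.le F hF ε hε hFε) _)
  rw [hEV, ← ENNReal.ofReal_mul ht.le, ← ENNReal.ofReal_mul hCH, ← ENNReal.ofReal_add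
    (by positivity) (by positivity), ENNReal.ofReal_le_ofReal_iff (by positivity)] at h2
  have h3 : V * (t * V) ≤ V * (CH * V + 2 * ε) := by nlinarith
  have h4 := le_of_mul_le_mul_left h3 hVp
  nlinarith

lemma lp_of_weak (g : ℂ → ℝ) (hg : Measurable g) (hg0 : ∀ x, 0 ≤ g x) (C : ℝ) 
    (hw : wL2Bound g (ball (0:ℂ) (1/2)) C) (p : ℝ) (hp1 : 1 < p) (hp2 : p < 2) :
    ∫⁻ x in ball (0:ℂ) (1/2), ENNReal.ofReal (g x ^ p) ≤
      ENNReal.ofReal (p * (1 + C ^ 2 / (2 - p))) := by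
  set Ω := ball (0:ℂ) (1/2) with hΩ
  rw [lintegral_rpow_eq_lintegral_meas_lt_mul _ (Eventually.of_forall hg0) hg.aemeasurable
    (by linarith : 0 < p), ENNReal.ofReal_mul (by linarith)]
  gcongr
  have hset : ∀ t, (volume.restrict Ω) {a | t < g a} = volume {x ∈ Ω | t < |g x|} := by
    intro t
    rw [Measure.restrict_apply (measurableSet_lt measurable_const hg)]
    congr 1
    ext x
    simp only [Set.mem_inter_iff, Set.mem_ofPred_eq, abs_of_nonneg (hg0 x)]
    exact and_comm
  have hle1 : ∀ t, (volume.restrict Ω) {a | t < g a} ≤ 1 := fun t => by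
    rw [hset]; exact (measure_mono fun x hx => hx.1).trans vol_half_le
  have hle2 : ∀ t, 0 < t → (volume.restrict Ω) {a | t < g a} ≤ ENNReal.ofReal (C ^ 2 * t ^ (-2:ℝ)) := by
    intro t ht
    have h1 := hw t ht
    have hfin : volume {x ∈ Ω | t < |g x|} ≠ ∞ := by
      rw [← hset]; exact ne_top_of_le_ne_top ENNReal.one_ne_top (hle1 t)
    rw [hset, ← ENNReal.ofReal_toReal hfin]
    apply ENNReal.ofReal_le_ofReal
    rw [← Real.sqrt_eq_rpow] at h1
    set m := (volume {x ∈ Ω | t < |g x|}).toReal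
    have hm : 0 ≤ m := ENNReal.toReal_nonneg
    rw [Real.rpow_neg ht.le, ← div_eq_mul_inv, le_div_iff₀ (by positivity)]
    have h2 : (t * Real.sqrt m) ^ 2 ≤ C ^ 2 := by gcongr
    rw [mul_pow, Real.sq_sqrt hm] at h2
    norm_num
    linarith
  have hsplit : Set.Ioi (0:ℝ) = Set.Ioc 0 1 ∪ Set.Ioi 1 := (Set.Ioc_union_Ioi_eq_Ioi zero_le_one).symm
  rw [hsplit]
  refine (lintegral_union_le _ _ _).trans ?_
  rw [ENNReal.ofReal_add zero_le_one (by have : 0 < 2 - p := by linarith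
                                         positivity)]
  apply add_le_add
  · calc _ ≤ ∫⁻ t in Set.Ioc (0:ℝ) 1, (1 : ℝ≥0∞) := by
          apply setLIntegral_mono' measurableSet_Ioc
          intro t ht
          refine mul_le_one' (hle1 t) ?_
          rw [ENNReal.ofReal_le_one]
          exact Real.rpow_le_one ht.1.le ht.2 (by linarith)
      _ = _ := by rw [setLIntegral_one, Real.volume_Ioc]; simp
  · have hint := integrableOn_Ioi_rpow_of_lt (a := p - 3) (by linarith) zero_lt_one
    have hval := integral_Ioi_rpow_of_lt (a := p - 3) (by linarith) zero_lt_one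
    calc _ ≤ ∫⁻ t in Set.Ioi (1:ℝ), ENNReal.ofReal (C ^ 2 * t ^ (p - 3)) := by
          apply setLIntegral_mono' measurableSet_Ioi
          intro t ht
          have ht0 : (0:ℝ) < t := lt_trans zero_lt_one ht
          refine (mul_le_mul_left (hle2 t ht0) _).trans ?_
          rw [← ENNReal.ofReal_mul (by positivity), mul_assoc, ← Real.rpow_add ht0]
          apply le_of_eq; congr 3; ring
      _ = ENNReal.ofReal (∫ t in Set.Ioi (1:ℝ), C ^ 2 * t ^ (p - 3)) := by
          rw [ofReal_integral_eq_lintegral_ofReal (hint.const_mul _)]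
          filter_upwards [ae_restrict_mem measurableSet_Ioi] with t ht
          have ht0 : (0:ℝ) < t := lt_trans zero_lt_one ht
          positivity
      _ ≤ _ := by
          apply ENNReal.ofReal_le_ofReal
          rw [integral_const_mul, hval, Real.one_rpow]
          apply le_of_eq
          have : p - 3 + 1 = -(2 - p) := by ring
          rw [this, neg_div_neg_eq]
          ring

/-- logarithmic potential -/
def logpot (F : ℂ → ℝ) (y : ℂ) : ℝ := (2 * Real.pi)⁻¹ * ∫ ζ, F ζ * Real.log ‖y - ζ‖

lemma int_log (F : ℂ → ℝ) (hF : Continuous F) (hFc : HasCompactSupport F) (y : ℂ) :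
    Integrable (fun ζ => F ζ * Real.log ‖y - ζ‖) := by
  have hG : Continuous (fun ζ => (F ζ : ℂ)) := by fun_prop
  have hGc : HasCompactSupport (fun ζ => (F ζ : ℂ)) := hFc.comp_left (g := fun r : ℝ => (r : ℂ)) (by simp)
  have h1 := (int_ker _ hG hGc y).norm
  have h2 : Integrable (fun ζ => ‖F ζ * ‖y - ζ‖‖) := by
    apply Integrable.norm
    apply Continuous.integrable_of_hasCompactSupport (by fun_prop)
    exact hFc.mul_right
  refine (h1.add h2).mono' ?_ ?_
  · apply Measurable.aestronglyMeasurable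
    have := hF.measurable
    fun_prop
  · refine Eventually.of_forall fun ζ => ?_
    simp only [norm_mul, norm_div, Pi.add_apply, Complex.norm_real, Real.norm_eq_abs, abs_norm]
    set x := ‖y - ζ‖ with hx
    have hx0 : 0 ≤ x := norm_nonneg _
    rcases hx0.eq_or_lt with h | h
    · rw [← h]; simp
    · have h3 : |Real.log x| ≤ x⁻¹ + x := by
        rw [abs_le]
        have := Real.log_le_sub_one_of_pos h
        have h4 := Real.log_le_sub_one_of_pos (inv_pos.2 h)
        rw [Real.log_inv] at h4
        have := inv_pos.2 h
        constructor <;> linarith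
      calc _ ≤ |F ζ| * (x⁻¹ + x) := by gcongr
        _ = _ := by ring

lemma log_line (y ζ : ℂ) (hy : y ≠ 0) (h : (ζ / y).im ≠ 0) :
    (∫ t in (0:ℝ)..1, y / ((t:ℂ) * y - ζ)).re = Real.log ‖y - ζ‖ - Real.log ‖ζ‖ := by
  set w := ζ / y with hw
  have hsl : ∀ t : ℝ, (t:ℂ) - w ∈ Complex.slitPlane := fun t => by
    right; simpa using h
  have hζ : ζ = w * y := by rw [hw]; field_simp
  have hζ0 : w ≠ 0 := fun h0 => h (by rw [h0]; simp)
  have hd : ∀ t : ℝ, HasDerivAt (fun t : ℝ => Complex.log ((t:ℂ) - w)) (y / ((t:ℂ) * y - ζ)) t := by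
    intro t
    have h1 : HasDerivAt (fun t : ℝ => (t:ℂ) - w) 1 t :=
      (Complex.ofRealCLM.hasDerivAt (x := t)).sub_const w
    have h2 := h1.clog_real (hsl t)
    refine h2.congr_deriv ?_
    have h3 : (t:ℂ) - w ≠ 0 := Complex.slitPlane_ne_zero (hsl t)
    have : (t:ℂ) * y - ζ = ((t:ℂ) - w) * y := by rw [hζ]; ring
    rw [this]; field_simp
  rw [intervalIntegral.integral_eq_sub_of_hasDerivAt (fun t _ => hd t)]
  · rw [Complex.sub_re, Complex.log_re, Complex.log_re]
    have e1 : y - ζ = (((1:ℝ):ℂ) - w) * y := by rw [hζ]; push_cast; ring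
    have e2 : ‖ζ‖ = ‖((0:ℝ):ℂ) - w‖ * ‖y‖ := by rw [hζ]; simp
    have hy' : ‖y‖ ≠ 0 := norm_ne_zero_iff.2 hy
    rw [e1, norm_mul, e2, Real.log_mul (norm_ne_zero_iff.2 (Complex.slitPlane_ne_zero (hsl 1))) hy',
      Real.log_mul (norm_ne_zero_iff.2 (Complex.slitPlane_ne_zero (hsl 0))) hy']
    ring
  · apply Continuous.intervalIntegrable
    apply Continuous.div (by fun_prop) (by fun_prop)
    intro t h0
    have : (t:ℂ) * y - ζ = ((t:ℂ) - w) * y := by rw [hζ]; ring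
    rw [this] at h0
    exact (mul_ne_zero (Complex.slitPlane_ne_zero (hsl t)) hy) h0

lemma ae_off_line (y : ℂ) (hy : y ≠ 0) : ∀ᵐ ζ : ℂ, (ζ / y).im ≠ 0 := by
  set l : ℂ →ₗ[ℝ] ℝ := Complex.imLm ∘ₗ LinearMap.mulRight ℝ y⁻¹ with hl
  have h : volume (LinearMap.ker l : Set ℂ) = 0 := by
    apply Measure.addHaar_submodule
    intro htop
    have : (Complex.I * y) ∈ LinearMap.ker l := by rw [htop]; trivial
    simp [hl, hy] at this
  rw [ae_iff]
  convert h using 2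
  ext ζ
  simp [hl, div_eq_mul_inv]

lemma pot_line (F : ℂ → ℝ) (hF : Continuous F) (hFc : HasCompactSupport F)
    (hF0 : ∀ ζ, ζ ∉ ball (0:ℂ) 1 → F ζ = 0) (y : ℂ) :
    (∫ t in (0:ℝ)..1, pot F ((t:ℂ) * y) * y).re = logpot F y - logpot F 0 := by
  by_cases hy : y = 0
  · simp [hy]
  have hFm := hF.measurable
  obtain ⟨B, hB⟩ := hF.bounded_above_of_compact_support hFc
  have hB0 : 0 ≤ B := (norm_nonneg _).trans (hB 0)
  set f : ℝ → ℂ → ℂ := fun t ζ => (F ζ : ℂ) * (y / ((t:ℂ) * y - ζ)) with hf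
  have hfint : Integrable (Function.uncurry f)
      ((volume.restrict (Set.Ioc (0:ℝ) 1)).prod (volume : Measure ℂ)) := by
    have hm : Measurable (Function.uncurry f) := by
      unfold Function.uncurry
      simp only [hf]
      fun_prop
    refine ⟨hm.aestronglyMeasurable, ?_⟩
    rw [hasFiniteIntegral_iff_enorm, lintegral_prod _ hm.enorm.aemeasurable]
    have hin : ∀ t : ℝ, ∫⁻ ζ, ‖Function.uncurry f (t, ζ)‖ₑ ≤
        ENNReal.ofReal (B * ‖y‖) * ENNReal.ofReal (8 * 2) := by
      intro t
      have h1 : ∀ ζ, ‖Function.uncurry f (t, ζ)‖ₑ ≤ (ball (0:ℂ) 1).indicator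
          (fun ζ => ENNReal.ofReal (B * ‖y‖) * ‖ζ - (t:ℂ) * y‖ₑ⁻¹) ζ := by
        intro ζ
        by_cases hζ : ζ ∈ ball (0:ℂ) 1
        · rw [Set.indicator_of_mem hζ]
          simp only [Function.uncurry, hf]
          by_cases h0 : (t:ℂ) * y - ζ = 0
          · simp [h0]
          rw [div_eq_mul_inv, ← mul_assoc, enorm_mul, enorm_inv h0, enorm_mul, ENNReal.ofReal_mul hB0,
            ofReal_norm, enorm_sub_rev ζ]
          gcongr
          rw [← ofReal_norm, Complex.norm_real]
          exact ENNReal.ofReal_le_ofReal (hB ζ)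
        · simp [Function.uncurry, hf, hF0 ζ hζ]
      refine (lintegral_mono h1).trans ?_
      rw [lintegral_indicator measurableSet_ball, lintegral_const_mul _ (by fun_prop)]
      gcongr
      apply ker_set _ 2 (by norm_num)
      rw [Complex.volume_ball]
      have : (NNReal.pi : ℝ≥0∞) = ENNReal.ofReal Real.pi := by
        rw [← NNReal.coe_real_pi, ENNReal.ofReal_coe_nnreal]
      rw [this]
      simp only [ENNReal.ofReal_one, one_pow, one_mul]
      exact ENNReal.ofReal_le_ofReal (by linarith [Real.pi_le_four])
    refine (lintegral_mono hin).trans_lt ?_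
    rw [lintegral_const]
    apply ENNReal.mul_lt_top (ENNReal.mul_lt_top ENNReal.ofReal_lt_top ENNReal.ofReal_lt_top)
    simp
  have e1 : ∫ t in (0:ℝ)..1, pot F ((t:ℂ) * y) * y =
      ((2 * Real.pi)⁻¹ : ℝ) * ∫ ζ, ∫ t in Set.Ioc (0:ℝ) 1, f t ζ := by
    rw [intervalIntegral.integral_of_le zero_le_one, ← integral_integral_swap hfint,
      ← integral_const_mul]
    congr 1
    ext t
    unfold pot
    rw [mul_assoc, ← integral_mul_const]
    congr 2
    ext ζ
    simp only [hf]; ring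
  have hI := hfint.integral_prod_right
  simp only [Function.uncurry] at hI
  rw [e1, Complex.re_ofReal_mul]
  have e2 : (∫ ζ, ∫ t in Set.Ioc (0:ℝ) 1, f t ζ).re = ∫ ζ, (∫ t in Set.Ioc (0:ℝ) 1, f t ζ).re :=
    (integral_re hI).symm
  have e3 : ∫ ζ, (∫ t in Set.Ioc (0:ℝ) 1, f t ζ).re =
      ∫ ζ, (F ζ * Real.log ‖y - ζ‖ - F ζ * Real.log ‖0 - ζ‖) := by
    apply integral_congr_ae
    filter_upwards [ae_off_line y hy] with ζ hζ
    simp only [hf]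
    rw [integral_const_mul, Complex.re_ofReal_mul, ← intervalIntegral.integral_of_le zero_le_one,
      log_line y ζ hy hζ, zero_sub, norm_neg]
    ring
  rw [e2, e3, integral_sub (int_log F hF hFc y) (int_log F hF hFc 0)]
  unfold logpot
  ring

lemma rep (u : ℂ → ℝ) (hu : ContDiffOn ℝ (⊤ : ℕ∞) u (ball (0:ℂ) 1))
    (F : ℂ → ℝ) (hF : Continuous F) (hFc : HasCompactSupport F)
    (hF0 : ∀ ζ, ζ ∉ ball (0:ℂ) 1 → F ζ = 0) (H : ℂ → ℂ)
    (hH : DifferentiableOn ℂ H (ball 0 (7/8)))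
    (hdec : ∀ z ∈ ball (0:ℂ) (7/8), gr u z = H z + pot F z) (CH : ℝ) (hCH : 0 ≤ CH)
    (hHb : ∀ z ∈ ball (0:ℂ) (1/2), ‖H z‖ ≤ CH) :
    ∀ y ∈ ball (0:ℂ) (1/2), |u y - (u 0 - logpot F 0) - logpot F y| ≤ CH := by
  intro y hy
  have hyn : ‖y‖ < 1/2 := by simpa using hy
  have hty : ∀ t ∈ Set.Icc (0:ℝ) 1, (t:ℂ) * y ∈ ball (0:ℂ) (1/2) := by
    intro t ht
    rw [mem_ball_zero_iff, norm_mul, Complex.norm_real, Real.norm_eq_abs, abs_of_nonneg ht.1]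
    nlinarith [ht.2, norm_nonneg y]
  have h78 : ball (0:ℂ) (1/2) ⊆ ball 0 (7/8) := ball_subset_ball (by norm_num)
  have h1b : ball (0:ℂ) (1/2) ⊆ ball 0 1 := ball_subset_ball (by norm_num)
  have hline : Continuous (fun t : ℝ => (t:ℂ) * y) := by fun_prop
  have hgc : ContinuousOn (fun t : ℝ => gr u ((t:ℂ) * y) * y) (Set.Icc 0 1) := by
    apply ContinuousOn.mul _ continuousOn_const
    intro s hs
    have h1 := (dbar_gr u _ (hu.contDiffAt (isOpen_ball.mem_nhds (h1b (hty s hs))))).1.continuousAt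
    exact (ContinuousAt.comp (f := fun t : ℝ => (t:ℂ) * y) h1 hline.continuousAt).continuousWithinAt
  have hHc : ContinuousOn (fun t : ℝ => H ((t:ℂ) * y) * y) (Set.Icc 0 1) := by
    apply ContinuousOn.mul _ continuousOn_const
    exact hH.continuousOn.comp hline.continuousOn fun t ht => h78 (hty t ht)
  have hpc : ContinuousOn (fun t : ℝ => pot F ((t:ℂ) * y) * y) (Set.Icc 0 1) := by
    refine (hgc.sub hHc).congr ?_
    intro t ht
    simp only
    rw [Pi.sub_apply, hdec _ (h78 (hty t ht))]; ring
  have hii : ∀ g : ℝ → ℂ, ContinuousOn g (Set.Icc 0 1) → IntervalIntegrable g volume 0 1 := by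
    intro g hg
    apply ContinuousOn.intervalIntegrable
    rwa [Set.uIcc_of_le zero_le_one]
  have hftc : ∫ t in (0:ℝ)..1, (gr u ((t:ℂ) * y) * y).re = u y - u 0 := by
    have := intervalIntegral.integral_eq_sub_of_hasDerivAt (a := 0) (b := 1)
      (f := fun t : ℝ => u ((t:ℂ) * y)) (f' := fun t : ℝ => (gr u ((t:ℂ) * y) * y).re) ?_ ?_
    · simpa using this
    · intro t ht
      rw [Set.uIcc_of_le zero_le_one] at ht
      have hd : HasDerivAt (fun s : ℝ => (s:ℂ) * y) (1 * y) t :=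
        ((Complex.ofRealCLM.hasDerivAt (x := t)).mul_const y)
      have h2 : HasFDerivAt u (fderiv ℝ u ((t:ℂ) * y)) ((t:ℂ) * y) :=
        ((hu.contDiffAt (isOpen_ball.mem_nhds (h1b (hty t ht)))).differentiableAt
          (by simp)).hasFDerivAt
      have h3 := h2.comp_hasDerivAt t hd
      refine h3.congr_deriv ?_
      rw [fderiv_eq_gr, one_mul]
    · apply ContinuousOn.intervalIntegrable
      rw [Set.uIcc_of_le zero_le_one]
      exact Complex.continuous_re.comp_continuousOn hgc
  have e1 : ∫ t in (0:ℝ)..1, (gr u ((t:ℂ) * y) * y).re = (∫ t in (0:ℝ)..1, gr u ((t:ℂ) * y) * y).re :=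
    intervalIntegral.intervalIntegral_re (𝕜 := ℂ) (hii _ hgc)
  have e2 : ∫ t in (0:ℝ)..1, gr u ((t:ℂ) * y) * y =
      (∫ t in (0:ℝ)..1, H ((t:ℂ) * y) * y) + ∫ t in (0:ℝ)..1, pot F ((t:ℂ) * y) * y := by
    rw [← intervalIntegral.integral_add (hii _ hHc) (hii _ hpc)]
    apply intervalIntegral.integral_congr
    intro t ht
    rw [Set.uIcc_of_le zero_le_one] at ht
    simp only
    rw [hdec _ (h78 (hty t ht))]; ring
  rw [e1, e2, Complex.add_re, pot_line F hF hFc hF0 y] at hftc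
  have e3 : u y - (u 0 - logpot F 0) - logpot F y = (∫ t in (0:ℝ)..1, H ((t:ℂ) * y) * y).re := by
    linarith
  rw [e3]
  refine (Complex.abs_re_le_norm _).trans ?_
  have := intervalIntegral.norm_integral_le_of_norm_le_const (a := 0) (b := 1)
    (f := fun t : ℝ => H ((t:ℂ) * y) * y) (C := CH) ?_
  · simpa using this
  · intro t ht
    rw [Set.uIoc_of_le zero_le_one] at ht
    rw [norm_mul]
    have := hHb _ (hty t ⟨ht.1.le, ht.2⟩)
    nlinarith [norm_nonneg y, norm_nonneg (H ((t:ℂ) * y))]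

lemma logpot_exp (F : ℂ → ℝ) (hF : Continuous F) (hFc : HasCompactSupport F)
    (hF0 : ∀ ζ, ζ ∉ ball (0:ℂ) 1 → F ζ = 0) (hF1 : ∫⁻ ζ, ‖F ζ‖ₑ ≤ 1)
    (y : ℂ) (hy : y ∈ ball (0:ℂ) (1/2)) :
    ENNReal.ofReal (Real.exp (2 * |logpot F y|)) ≤
      ENNReal.ofReal (Real.exp 1) * (1 + ENNReal.ofReal 4 * ∫⁻ ζ, ‖F ζ‖ₑ * ‖y - ζ‖ₑ⁻¹) := by
  have hyn : ‖y‖ < 1/2 := by simpa using hy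
  have hpi := Real.pi_gt_three
  have hG : Continuous (fun ζ => (F ζ : ℂ)) := by fun_prop
  have hGc : HasCompactSupport (fun ζ => (F ζ : ℂ)) := hFc.comp_left (g := fun r : ℝ => (r : ℂ)) (by simp)
  have hK : Integrable (fun ζ => |F ζ| * ‖y - ζ‖⁻¹) := by
    have h1 := (int_ker _ hG hGc y).norm
    refine h1.congr (Eventually.of_forall fun ζ => ?_)
    simp [div_eq_mul_inv]
  have hFi : Integrable (fun ζ => |F ζ|) := (hF.integrable_of_hasCompactSupport hFc).abs
  set A := ∫ ζ, |F ζ| * ‖y - ζ‖⁻¹ with hA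
  have hA0 : 0 ≤ A := integral_nonneg fun ζ => by positivity
  have hm : ∫ ζ, |F ζ| ≤ 1 := by
    have h1 : ENNReal.ofReal (∫ ζ, |F ζ|) ≤ 1 := by
      rw [ofReal_integral_eq_lintegral_ofReal hFi (Eventually.of_forall fun ζ => abs_nonneg _)]
      refine le_trans (le_of_eq ?_) hF1
      congr 1; ext ζ; rw [← ofReal_norm]; rfl
    rwa [ENNReal.ofReal_le_one] at h1
  have hm0 : 0 ≤ ∫ ζ, |F ζ| := integral_nonneg fun ζ => abs_nonneg _
  have hAe : ENNReal.ofReal A ≤ ∫⁻ ζ, ‖F ζ‖ₑ * ‖y - ζ‖ₑ⁻¹ := by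
    rw [hA, ofReal_integral_eq_lintegral_ofReal hK (Eventually.of_forall fun ζ => by
      simp only [Pi.zero_apply]; positivity)]
    apply lintegral_mono
    intro ζ
    simp only
    by_cases h0 : y - ζ = 0
    · simp [h0]
    rw [ENNReal.ofReal_mul (abs_nonneg _), ← norm_inv, ofReal_norm, enorm_inv h0,
      ← Real.norm_eq_abs, ofReal_norm]
  set a := 1 + 4 * A with ha
  have ha1 : 1 ≤ a := by linarith
  have hla : 0 ≤ Real.log a := Real.log_nonneg ha1
  have hpt : ∀ ζ, ‖F ζ * Real.log ‖y - ζ‖‖ ≤ 4 / a * (|F ζ| * ‖y - ζ‖⁻¹) + Real.log a * |F ζ| := by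
    intro ζ
    by_cases hζ : ζ ∈ ball (0:ℂ) 1
    swap
    · simp [hF0 ζ hζ]
    have hζn : ‖ζ‖ < 1 := by simpa using hζ
    set x := ‖y - ζ‖ with hx
    have hx2 : x < 2 := (norm_sub_le y ζ).trans_lt (by linarith)
    have hx0 : 0 ≤ x := norm_nonneg _
    rw [norm_mul, Real.norm_eq_abs, Real.norm_eq_abs]
    have key : |Real.log x| ≤ 4 / a * x⁻¹ + Real.log a := by
      rcases hx0.eq_or_lt with h | h
      · rw [← h]; simpa using hla
      · have h1 : |Real.log x| ≤ Real.log (4 / x) := by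
          rw [Real.log_div (by norm_num) h.ne', abs_le]
          have h4 : Real.log 4 = 2 * Real.log 2 := by
            rw [show (4:ℝ) = 2 ^ 2 by norm_num, Real.log_pow]; push_cast; ring
          have h5 : Real.log x ≤ Real.log 2 := Real.log_le_log h hx2.le
          have h6 : 0 < Real.log 2 := Real.log_pos (by norm_num)
          constructor <;> linarith
        have h2 : Real.log (4 / x) = Real.log (4 / a * x⁻¹) + Real.log a := by
          rw [← Real.log_mul (by positivity) (by positivity)]
          congr 1; field_simp
        have h3 := Real.log_le_sub_one_of_pos (show 0 < 4 / a * x⁻¹ by positivity)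
        linarith
    calc _ ≤ |F ζ| * (4 / a * x⁻¹ + Real.log a) := by gcongr
      _ = _ := by ring
  have hv : |∫ ζ, F ζ * Real.log ‖y - ζ‖| ≤ 4 / a * A + Real.log a := by
    have h1 := norm_integral_le_of_norm_le ((hK.const_mul (4 / a)).add (hFi.const_mul (Real.log a)))
      (Eventually.of_forall hpt)
    simp only [Pi.add_apply] at h1
    rw [integral_add (hK.const_mul (4 / a)) (hFi.const_mul (Real.log a)), integral_const_mul,
      integral_const_mul] at h1
    rw [Real.norm_eq_abs] at h1
    refine h1.trans ?_
    have : Real.log a * ∫ ζ, |F ζ| ≤ Real.log a := mul_le_of_le_one_right hla hm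
    linarith
  have hv2 : 2 * |logpot F y| ≤ 1 + Real.log a := by
    unfold logpot
    rw [abs_mul, abs_of_nonneg (by positivity)]
    have h1 : 4 / a * A ≤ 1 := by
      rw [div_mul_eq_mul_div, div_le_one (by positivity)]; linarith
    have h2 : 2 * (2 * Real.pi)⁻¹ ≤ 1 := by
      rw [mul_inv, ← mul_assoc]
      norm_num
      exact inv_le_one_of_one_le₀ (by linarith)
    calc _ = 2 * (2 * Real.pi)⁻¹ * |∫ ζ, F ζ * Real.log ‖y - ζ‖| := by ring
      _ ≤ 1 * |∫ ζ, F ζ * Real.log ‖y - ζ‖| := by gcongr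
      _ ≤ _ := by linarith
  calc ENNReal.ofReal (Real.exp (2 * |logpot F y|)) ≤ ENNReal.ofReal (Real.exp 1 * a) := by
        apply ENNReal.ofReal_le_ofReal
        calc _ ≤ Real.exp (1 + Real.log a) := Real.exp_le_exp.2 hv2
          _ = _ := by rw [Real.exp_add, Real.exp_log (by positivity)]
    _ = ENNReal.ofReal (Real.exp 1) * (1 + ENNReal.ofReal 4 * ENNReal.ofReal A) := by
        rw [ENNReal.ofReal_mul (by positivity), ha, ENNReal.ofReal_add zero_le_one (by positivity),
          ENNReal.ofReal_mul (by norm_num), ENNReal.ofReal_one]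
    _ ≤ _ := by gcongr

lemma logpot_exp_int (F : ℂ → ℝ) (hF : Continuous F) (hFc : HasCompactSupport F)
    (hF0 : ∀ ζ, ζ ∉ ball (0:ℂ) 1 → F ζ = 0) (hF1 : ∫⁻ ζ, ‖F ζ‖ₑ ≤ 1) :
    ∫⁻ y in ball (0:ℂ) (1/2), ENNReal.ofReal (Real.exp (2 * |logpot F y|)) ≤ ENNReal.ofReal 99 := by
  have hFm := hF.measurable
  have hFm2 : Measurable fun y : ℂ => ∫⁻ ζ, ‖F ζ‖ₑ * ‖y - ζ‖ₑ⁻¹ := by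
    apply Measurable.lintegral_prod_right' (f := fun p : ℂ × ℂ => ‖F p.2‖ₑ * ‖p.1 - p.2‖ₑ⁻¹)
    fun_prop
  refine (setLIntegral_mono' measurableSet_ball
    (logpot_exp F hF hFc hF0 hF1)).trans ?_
  rw [lintegral_const_mul _ (by fun_prop), lintegral_add_left measurable_const,
    lintegral_const_mul _ hFm2, setLIntegral_one]
  have h1 := ker_tonelli (ball (0:ℂ) (1/2)) 1 one_pos (by simpa using vol_half_le) F hFm 1 zero_le_one
    (by simpa using hF1) (fun ζ => ζ) measurable_id
  calc _ ≤ ENNReal.ofReal (Real.exp 1) * (1 + ENNReal.ofReal 4 * ENNReal.ofReal (8 * 1 * 1)) := by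
        gcongr
        exact vol_half_le
    _ = ENNReal.ofReal (Real.exp 1 * (1 + 4 * (8 * 1 * 1))) := by
        rw [← ENNReal.ofReal_one, ← ENNReal.ofReal_mul (by norm_num),
          ← ENNReal.ofReal_add zero_le_one (by positivity), ← ENNReal.ofReal_mul (by positivity)]
    _ ≤ _ := by
        apply ENNReal.ofReal_le_ofReal
        have := Real.exp_one_lt_d9
        linarith

lemma lp_u (u : ℂ → ℝ) (hu : ContDiffOn ℝ (⊤ : ℕ∞) u (ball (0:ℂ) 1))
    (k C1 : ℝ) (hC1 : 1 ≤ C1)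
    (hw : ∫⁻ y in ball (0:ℂ) (1/2), ENNReal.ofReal (Real.exp (2 * |u y - k|)) ≤ ENNReal.ofReal C1)
    (p : ℝ) (hp1 : 1 < p) (hp2 : p < 2) :
    (∫⁻ x in ball (0:ℂ) (1/2), ENNReal.ofReal (|u x| ^ p)) ^ (1/p) ≤
      ENNReal.ofReal (C1 * (1 + 4 * C1) *
        (1 + |Real.log ((confAreaE u (ball (0:ℂ) (1/2))).toReal)|)) := by
  set D := ball (0:ℂ) (1/2) with hD
  have hDm : MeasurableSet D := measurableSet_ball
  have huc : ContinuousOn u D := hu.continuousOn.mono (ball_subset_ball (by norm_num))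
  set J := ∫⁻ y in D, ENNReal.ofReal (Real.exp (2 * (u y - k))) with hJ
  have hJle : J ≤ ENNReal.ofReal C1 := by
    refine le_trans (lintegral_mono fun y => ?_) hw
    apply ENNReal.ofReal_le_ofReal
    apply Real.exp_le_exp.2
    linarith [le_abs_self (u y - k)]
  have hJfin : J ≠ ∞ := ne_top_of_le_ne_top ENNReal.ofReal_ne_top hJle
  have hJge : C1 ≤ 4 * C1 ^ 2 * J.toReal := by
    have h1 : ∫⁻ y in D, ENNReal.ofReal (4 * C1) ≤ ∫⁻ y in D,
        (ENNReal.ofReal (4 * C1 ^ 2) * ENNReal.ofReal (Real.exp (2 * (u y - k))) +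
          ENNReal.ofReal (Real.exp (2 * |u y - k|))) := by
      apply lintegral_mono
      intro y
      simp only
      rw [← ENNReal.ofReal_mul (by positivity), ← ENNReal.ofReal_add (by positivity) (by positivity)]
      apply ENNReal.ofReal_le_ofReal
      set w := u y - k
      have h2 : Real.exp (-(2 * w)) ≤ Real.exp (2 * |w|) :=
        Real.exp_le_exp.2 (by linarith [neg_abs_le w])
      have h3 : Real.exp (2 * w) = Real.exp w ^ 2 := by
        rw [← Real.exp_nat_mul]; push_cast; rfl
      have h4 : Real.exp (-(2 * w)) = Real.exp (-w) ^ 2 := by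
        rw [← Real.exp_nat_mul]; congr 1; push_cast; ring
      have h5 : Real.exp w * Real.exp (-w) = 1 := by rw [← Real.exp_add]; simp
      rw [h3]
      rw [h4] at h2
      nlinarith [sq_nonneg (2 * C1 * Real.exp w - Real.exp (-w))]
    have hmeas : AEMeasurable (fun y => ENNReal.ofReal (Real.exp (2 * (u y - k)))) (volume.restrict D) := by
      have : AEMeasurable u (volume.restrict D) := huc.aemeasurable hDm
      fun_prop
    rw [lintegral_add_left' (hmeas.const_mul _), lintegral_const_mul'' _ hmeas, setLIntegral_const,
      ← hJ, vol_half, ← ENNReal.ofReal_toReal hJfin] at h1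
    have h2 := h1.trans (add_le_add_right hw _)
    have hj0 : 0 ≤ J.toReal := ENNReal.toReal_nonneg
    rw [← ENNReal.ofReal_mul (by positivity), ← ENNReal.ofReal_mul (by positivity),
      ← ENNReal.ofReal_add (by positivity) (by positivity),
      ENNReal.ofReal_le_ofReal_iff (by positivity)] at h2
    nlinarith [Real.pi_gt_three]
  have hJle' : J.toReal ≤ C1 := by
    have := ENNReal.toReal_mono ENNReal.ofReal_ne_top hJle
    rwa [ENNReal.toReal_ofReal (by linarith)] at this
  set j := J.toReal with hj
  have hj1 : 1 ≤ 4 * C1 * j := by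
    have : C1 * 1 ≤ C1 * (4 * C1 * j) := by linarith
    exact le_of_mul_le_mul_left this (by linarith)
  have hjp : 0 < j := by
    by_contra! h
    nlinarith
  have hμ : (confAreaE u D).toReal = Real.exp (2 * k) * j := by
    have : confAreaE u D = ENNReal.ofReal (Real.exp (2 * k)) * J := by
      unfold confAreaE
      rw [hJ, ← lintegral_const_mul' _ _ ENNReal.ofReal_ne_top]
      congr 1
      ext y
      rw [← ENNReal.ofReal_mul (by positivity), ← Real.exp_add]
      congr 2; ring
    rw [this, ENNReal.toReal_mul, ENNReal.toReal_ofReal (by positivity)]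
  have hlogj : |Real.log j| ≤ 4 * C1 := by
    rw [abs_le]
    have h1 := Real.log_le_sub_one_of_pos hjp
    have h2 := Real.log_le_sub_one_of_pos (inv_pos.2 hjp)
    rw [Real.log_inv] at h2
    have h3 : j⁻¹ ≤ 4 * C1 := by rw [inv_le_iff_one_le_mul₀ hjp]; linarith
    constructor <;> linarith
  have hk : 1 + |k| ≤ (1 + 4 * C1) * (1 + |Real.log ((confAreaE u D).toReal)|) := by
    rw [hμ, Real.log_mul (Real.exp_pos _).ne' hjp.ne', Real.log_exp]
    have h1 : |2 * k| ≤ |2 * k + Real.log j| + |Real.log j| := by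
      have := abs_sub (2 * k + Real.log j) (Real.log j)
      rwa [add_sub_cancel_right] at this
    rw [abs_mul, abs_of_pos (by norm_num : (0:ℝ) < 2)] at h1
    nlinarith [abs_nonneg k, abs_nonneg (2 * k + Real.log j)]
  set K := 1 + |k| with hK
  have hK1 : 1 ≤ K := by linarith [abs_nonneg k]
  have hint : ∫⁻ x in D, ENNReal.ofReal (|u x| ^ p) ≤ ENNReal.ofReal (K ^ p * C1) := by
    rw [ENNReal.ofReal_mul (by positivity)]
    refine le_trans ?_ (mul_le_mul_right hw _)
    rw [← lintegral_const_mul' _ _ ENNReal.ofReal_ne_top]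
    apply lintegral_mono
    intro x
    simp only
    rw [← ENNReal.ofReal_mul (by positivity)]
    apply ENNReal.ofReal_le_ofReal
    set w := u x - k with hw'
    have h1 : |u x| ≤ K * (1 + |w|) := by
      have : u x = w + k := by rw [hw']; ring
      rw [this]
      refine (abs_add_le _ _).trans ?_
      rw [hK]
      nlinarith [abs_nonneg k, abs_nonneg w]
    calc |u x| ^ p ≤ (K * (1 + |w|)) ^ p := by gcongr
      _ = K ^ p * (1 + |w|) ^ p := Real.mul_rpow (by positivity) (by positivity)
      _ ≤ K ^ p * (1 + |w|) ^ (2:ℝ) := by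
          gcongr
          linarith [abs_nonneg w]
      _ ≤ K ^ p * Real.exp (2 * |w|) := by
          gcongr
          have : Real.exp (2 * |w|) = Real.exp |w| ^ 2 := by
            rw [← Real.exp_nat_mul]; push_cast; rfl
          rw [this, Real.rpow_ofNat]
          gcongr
          linarith [Real.add_one_le_exp |w|]
  calc _ ≤ (ENNReal.ofReal (K ^ p * C1)) ^ (1/p) := by gcongr
    _ = ENNReal.ofReal ((K ^ p * C1) ^ (1/p)) := ENNReal.ofReal_rpow_of_nonneg (by positivity) (by positivity)
    _ ≤ ENNReal.ofReal (C1 * (1 + 4 * C1) *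
        (1 + |Real.log ((confAreaE u D).toReal)|)) := by
        apply ENNReal.ofReal_le_ofReal
        rw [Real.mul_rpow (by positivity) (by positivity), ← Real.rpow_mul (by positivity),
          mul_one_div_cancel (by linarith), Real.rpow_one]
        have h1 : C1 ^ (1/p) ≤ C1 := by
          calc C1 ^ (1/p) ≤ C1 ^ (1:ℝ) := by
                apply Real.rpow_le_rpow_of_exponent_le hC1
                rw [div_le_one (by linarith)]; linarith
            _ = C1 := Real.rpow_one _
        calc K * C1 ^ (1/p) ≤ ((1 + 4 * C1) * (1 + |Real.log ((confAreaE u D).toReal)|)) * C1 := by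
              gcongr
          _ = _ := by ring

/-- main `L^{2,∞}` and `W^{1,p}` estimate for a conformal metric on the disk
with small total curvature and Euclidean volume-growth bound. -/
theorem statement0 (Λ₁ : ℝ) (hΛ₁ : 0 < Λ₁) :
    ∃ ε₀ : ℝ, 0 < ε₀ ∧ ε₀ < 4 * Real.pi / 3 ∧
      ∃ C : ℝ, 0 < C ∧
        ∀ p : ℝ, 1 < p → p < 2 →
          ∃ Cp : ℝ, 0 < Cp ∧
            ∀ u : ℂ → ℝ, ContDiffOn ℝ (⊤ : ℕ∞) u (ball (0:ℂ) 1) →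
              (∀ r : ℝ, 0 < r → ∀ z ∈ ball (0:ℂ) (3/4),
                confAreaE u (confBall u (ball (0:ℂ) 1) z r)
                  < ENNReal.ofReal (Λ₁ * (Real.pi * r ^ 2))) →
              curvIntE u (ball (0:ℂ) 1) ≤ ENNReal.ofReal ε₀ →
              wL2Bound (fun x => ‖fderiv ℝ u x‖) (ball (0:ℂ) (1/2)) C ∧
              w1pNormE u (ball (0:ℂ) (1/2)) p ≤
                ENNReal.ofReal
                  (Cp * (1 + |Real.log ((confAreaE u (ball (0:ℂ) (1/2))).toReal)|)) := by
  obtain ⟨L, R, hL, hR, hRL, hbig⟩ := params Λ₁ hΛ₁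
  have hLR : 1 ≤ L * R := by nlinarith
  have hε0 : 0 < 1 / (16 * L * R) := by positivity
  have hε1 : 1 / (16 * L * R) ≤ 1 := by
    rw [div_le_one (by positivity)]; linarith
  set ε := 1 / (16 * L * R) with hε
  set CH := 4 * (2 * (2 * L + R) + 1 + 64 * L * R * (2 * L + R)) with hCH
  have hCH0 : 0 ≤ CH := by positivity
  set C1 := Real.exp (2 * CH) * 99 with hC1d
  have hC1 : 1 ≤ C1 := by
    have := Real.one_le_exp (show 0 ≤ 2 * CH by positivity)
    linarith
  refine ⟨ε, hε0, by linarith [Real.pi_gt_three], CH + 2, by positivity, fun p hp1 hp2 => ?_⟩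
  have hp2' : 0 < 2 - p := by linarith
  have hp0 : 0 < p := by linarith
  set G := p * (1 + (CH + 2) ^ 2 / (2 - p)) with hGd
  have hG1 : 1 ≤ G := by
    have h1 : 0 ≤ (CH + 2) ^ 2 / (2 - p) := by positivity
    nlinarith
  refine ⟨C1 * (1 + 4 * C1) + G, by positivity, fun u hu harea hcurv => ?_⟩
  obtain ⟨F, H, hF, hFc, hF0, hFl, hH, hdec⟩ := decomp u hu
  have hFε := F_int u F ε hF0 hFl hcurv
  have hHb : ∀ z ∈ ball (0:ℂ) (1/2), ‖H z‖ ≤ CH := H_bound' H _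
    (H_bound Λ₁ L R hL hR hRL hbig u hu harea F hF H hH hdec ε hε0.le
      (by rw [hε, mul_one_div_cancel (by positivity)]) hFε)
  have hweak := weakL2 u F hF H hdec ε hε0.le hε1 hFε CH hCH0 hHb
  refine ⟨hweak, ?_⟩
  have hgrad := lp_of_weak (fun x => ‖fderiv ℝ u x‖) (measurable_fderiv ℝ u).norm
    (fun x => norm_nonneg _) (CH + 2) hweak p hp1 hp2
  have hF1 : ∫⁻ ζ, ‖F ζ‖ₑ ≤ 1 := hFε.trans (by rwa [ENNReal.ofReal_le_one])
  have hw : ∫⁻ y in ball (0:ℂ) (1/2), ENNReal.ofReal (Real.exp (2 * |u y - (u 0 - logpot F 0)|))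
      ≤ ENNReal.ofReal C1 := by
    have h1 : ∀ y ∈ ball (0:ℂ) (1/2), ENNReal.ofReal (Real.exp (2 * |u y - (u 0 - logpot F 0)|)) ≤
        ENNReal.ofReal (Real.exp (2 * CH)) * ENNReal.ofReal (Real.exp (2 * |logpot F y|)) := by
      intro y hy
      have h2 := rep u hu F hF hFc hF0 H hH hdec CH hCH0 hHb y hy
      rw [← ENNReal.ofReal_mul (by positivity), ← Real.exp_add]
      apply ENNReal.ofReal_le_ofReal
      apply Real.exp_le_exp.2
      have h3 := abs_add_le (u y - (u 0 - logpot F 0) - logpot F y) (logpot F y)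
      rw [sub_add_cancel] at h3
      linarith
    refine (setLIntegral_mono' measurableSet_ball h1).trans ?_
    rw [lintegral_const_mul' _ _ ENNReal.ofReal_ne_top, hC1d, ENNReal.ofReal_mul (by positivity)]
    gcongr
    exact logpot_exp_int F hF hFc hF0 hF1
  have hlp := lp_u u hu _ C1 hC1 hw p hp1 hp2
  unfold w1pNormE
  set ℓ := |Real.log ((confAreaE u (ball (0:ℂ) (1/2))).toReal)| with hℓ
  have hℓ0 : 0 ≤ ℓ := abs_nonneg _
  have hg2 : (∫⁻ x in ball (0:ℂ) (1/2), ENNReal.ofReal (‖fderiv ℝ u x‖ ^ p)) ^ (1/p)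
      ≤ ENNReal.ofReal (G * (1 + ℓ)) := by
    calc _ ≤ (ENNReal.ofReal G) ^ (1/p) := by gcongr
      _ = ENNReal.ofReal (G ^ (1/p)) := ENNReal.ofReal_rpow_of_nonneg (by positivity) (by positivity)
      _ ≤ _ := by
        apply ENNReal.ofReal_le_ofReal
        calc G ^ (1/p) ≤ G ^ (1:ℝ) := by
              apply Real.rpow_le_rpow_of_exponent_le hG1
              rw [div_le_one (by linarith)]; linarith
          _ = G := Real.rpow_one _
          _ ≤ _ := by nlinarith
  refine (add_le_add hlp hg2).trans (le_of_eq ?_)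
  rw [← ENNReal.ofReal_add (by positivity) (by positivity)]
  congr 1
  ring
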